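/- arXiv:2404.14792 — 7 statements merged into one kernel-verified Lean document; each statement's English description precedes it below -/
import Mathlib

section
/- All geodesic triangles in an α_i-metric graph G are 3(i+1)-thin. Equivalently (in slice form): for all vertices x,y,z of an α_i-metric graph G, setting k = ⌊(x|z)_y⌋ where (x|z)_y = (d(x,y)+d(y,z)-d(x,z))/2 is the Gromov product, every z' ∈ S_k(y,x) and every x' ∈ S_k(y,z) satisfy d(z',x') ≤ 3(i+1). -/
/-- A graph `G` is `α_i`-metric if for all vertices `u, v, w, x` with `v ∈ I(u,w)`,
`w ∈ I(v,x)` and `v` adjacent to `w`, one has `d(u,x) ≥ d(u,v) + d(v,x) - i`. -/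
def alphaMetric {V : Type*} (G : SimpleGraph V) (i : ℕ) : Prop :=
  ∀ u v w x : V,
    G.dist u v + G.dist v w = G.dist u w →
    G.dist v w + G.dist w x = G.dist v x →
    G.Adj v w →
    G.dist u v + G.dist v x ≤ G.dist u x + i

/-- `x` belongs to the slice `S_k(u,v)`: it lies on a shortest `(u,v)`-path
at distance `k` from `u`. -/
def inSlice {V : Type*} (G : SimpleGraph V) (u v : V) (k : ℕ) (x : V) : Prop :=
  G.dist u x + G.dist x v = G.dist u v ∧ G.dist u x = k

/-- Every vertex other than `y` has a neighbour one step closer to `y`. -/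
theorem SimpleGraph.Connected.exists_adj_dist_eq {V : Type*} {G : SimpleGraph V}
    (hconn : G.Connected) {y a : V} {k : ℕ} (h : G.dist y a = k + 1) :
    ∃ c, G.Adj c a ∧ G.dist y c = k := by
  obtain ⟨p, hp⟩ := hconn.exists_walk_length_eq_dist a y
  rw [G.dist_comm, h] at hp
  cases p with
  | nil => simp at hp
  | @cons _ c _ hac q =>
    refine ⟨c, hac.symm, ?_⟩
    have h₁ := G.dist_le q
    have h₂ := hconn.dist_triangle (u := y) (v := c) (w := a)
    have h₃ : G.dist c a = 1 := SimpleGraph.dist_eq_one_iff_adj.mpr hac.symm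
    have h₄ := G.dist_comm (u := y) (v := c)
    simp only [SimpleGraph.Walk.length_cons] at hp
    omega

/-- If moving along an edge `vw` increases the distance to `u` by one and decreases the
distance to `x` by one, then `v` almost lies between `u` and `x`. -/
theorem alphaMetric.dist_add_dist_le {V : Type*} {G : SimpleGraph V} {i : ℕ}
    (halpha : alphaMetric G i) {u v w x : V} (hvw : G.Adj v w)
    (hu : G.dist u w = G.dist u v + 1) (hx : G.dist v x = G.dist w x + 1) :
    G.dist u v + G.dist v x ≤ G.dist u x + i := by
  have h₁ : G.dist v w = 1 := SimpleGraph.dist_eq_one_iff_adj.mpr hvw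
  exact halpha u v w x (by omega) (by omega) hvw

/-- Slices of intervals in an `α_i`-metric graph have diameter at most `i + 1`. -/
theorem alphaMetric.dist_le_of_inSlice {V : Type*} {G : SimpleGraph V}
    (hconn : G.Connected) {i : ℕ} (halpha : alphaMetric G i) {u v : V} (k : ℕ) {a b : V}
    (ha : inSlice G u v k a) (hb : inSlice G u v k b) : G.dist a b ≤ i + 1 := by
  induction k generalizing a b with
  | zero =>
    have h₁ := hconn.dist_triangle (u := a) (v := u) (w := b)
    have h₂ := G.dist_comm (u := a) (v := u)
    have h₃ := ha.2
    have h₄ := hb.2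
    omega
  | succ k ih =>
    obtain ⟨ha₁, ha₂⟩ := ha
    obtain ⟨hb₁, hb₂⟩ := hb
    by_contra! hD
    obtain ⟨a', haa, ha'⟩ := hconn.exists_adj_dist_eq ha₂
    obtain ⟨b', hbb, hb'⟩ := hconn.exists_adj_dist_eq hb₂
    have da : G.dist a' a = 1 := SimpleGraph.dist_eq_one_iff_adj.mpr haa
    have db : G.dist b' b = 1 := SimpleGraph.dist_eq_one_iff_adj.mpr hbb
    have t₁ := hconn.dist_triangle (u := a') (v := a) (w := v)
    have t₂ := hconn.dist_triangle (u := u) (v := a') (w := v)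
    have t₃ := hconn.dist_triangle (u := b') (v := b) (w := v)
    have t₄ := hconn.dist_triangle (u := u) (v := b') (w := v)
    have hIH := ih (a := a') (b := b') ⟨by omega, ha'⟩ ⟨by omega, hb'⟩
    have t₅ := hconn.dist_triangle (u := a') (v := a) (w := b)
    have t₆ := hconn.dist_triangle (u := a) (v := a') (w := b)
    have t₇ := hconn.dist_triangle (u := a') (v := b') (w := b)
    have c₁ := G.dist_comm (u := a) (v := a')
    have c₂ := G.dist_comm (u := b) (v := a)
    have c₃ := G.dist_comm (u := b) (v := a')
    have n₁ : G.dist a' b ≠ G.dist a b + 1 := fun h => by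
      have := halpha.dist_add_dist_le (u := u) haa (by omega) h
      omega
    have n₂ : G.dist a b ≠ G.dist a' b + 1 := fun h => by
      have := halpha.dist_add_dist_le (u := b) (x := v) haa (by omega) (by omega)
      omega
    have := halpha.dist_add_dist_le (u := a') (x := v) hbb (by omega) (by omega)
    omega

/-- A vertex `b` of the interval `I(y,z)` is at distance at most `p + 2i + 1` from any `x`
whose distances to `y` and `z` exceed those of `b` by at most `p`. -/
theorem alphaMetric.dist_le_of_mem_interval {V : Type*} {G : SimpleGraph V}
    (hconn : G.Connected) {i : ℕ} (halpha : alphaMetric G i) {x y z b : V} {p : ℕ}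
    (hb : G.dist y b + G.dist b z = G.dist y z)
    (hy : G.dist y x ≤ G.dist y b + p) (hz : G.dist z x ≤ G.dist z b + p) :
    G.dist b x ≤ p + 2 * i + 1 := by
  have key : ∀ r : ℕ, p + r + i ≤ G.dist b x →
      ∃ c, inSlice G y z (G.dist y b) c ∧ G.dist b c = r ∧ r + G.dist c x = G.dist b x := by
    intro r
    induction r with
    | zero => exact fun _ => ⟨b, ⟨hb, rfl⟩, by simp, by simp⟩
    | succ r ih =>
      intro hr
      obtain ⟨c, ⟨hc₁, hc₂⟩, hc₃, hc₄⟩ := ih (by omega)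
      have e₁ := G.dist_comm (u := x) (v := c)
      obtain ⟨c', hcc, hc'⟩ := hconn.exists_adj_dist_eq (y := x) (a := c)
        (k := G.dist c x - 1) (by omega)
      have d₁ : G.dist c c' = 1 := SimpleGraph.dist_eq_one_iff_adj.mpr hcc.symm
      have e₂ := G.dist_comm (u := x) (v := c')
      have e₃ := G.dist_comm (u := z) (v := c)
      have e₄ := G.dist_comm (u := z) (v := c')
      have e₅ := G.dist_comm (u := z) (v := b)
      have t₁ := hconn.dist_triangle (u := b) (v := c) (w := c')
      have t₂ := hconn.dist_triangle (u := b) (v := c') (w := x)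
      have t₃ := hconn.dist_triangle (u := y) (v := c) (w := c')
      have t₄ := hconn.dist_triangle (u := z) (v := c) (w := c')
      have t₅ := hconn.dist_triangle (u := y) (v := c') (w := z)
      have n₁ : G.dist y c' ≠ G.dist y c + 1 := fun h => by
        have := halpha.dist_add_dist_le (x := x) hcc.symm h (by omega)
        omega
      have n₂ : G.dist z c' ≠ G.dist z c + 1 := fun h => by
        have := halpha.dist_add_dist_le (x := x) hcc.symm h (by omega)
        omega
      exact ⟨c', ⟨by omega, by omega⟩, by omega, by omega⟩
  by_contra! h
  obtain ⟨c, hc, hbc, -⟩ := key (i + 2) (by omega)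
  have := halpha.dist_le_of_inSlice hconn _ (a := b) ⟨hb, rfl⟩ hc
  omega

/-- Points at equal distance from `y` on two sides of a geodesic triangle are close, as long as
that distance does not exceed the Gromov product. -/
theorem alphaMetric.dist_le_of_inSlice_of_inSlice {V : Type*} {G : SimpleGraph V}
    (hconn : G.Connected) {i : ℕ} (halpha : alphaMetric G i) {x y z : V} (k : ℕ) {a b : V}
    (ha : inSlice G y x k a) (hb : inSlice G y z k b)
    (hxz : G.dist x z ≤ G.dist a x + G.dist b z) : G.dist a b ≤ 3 * (i + 1) := by
  induction k generalizing a b with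
  | zero =>
    have h₁ := hconn.dist_triangle (u := a) (v := y) (w := b)
    have h₂ := G.dist_comm (u := a) (v := y)
    have h₃ := ha.2
    have h₄ := hb.2
    omega
  | succ k ih =>
    obtain ⟨ha₁, ha₂⟩ := ha
    obtain ⟨hb₁, hb₂⟩ := hb
    by_contra! hD
    obtain ⟨a', haa, ha'⟩ := hconn.exists_adj_dist_eq ha₂
    obtain ⟨b', hbb, hb'⟩ := hconn.exists_adj_dist_eq hb₂
    have da : G.dist a' a = 1 := SimpleGraph.dist_eq_one_iff_adj.mpr haa
    have db : G.dist b' b = 1 := SimpleGraph.dist_eq_one_iff_adj.mpr hbb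
    have t₁ := hconn.dist_triangle (u := a') (v := a) (w := x)
    have t₂ := hconn.dist_triangle (u := y) (v := a') (w := x)
    have t₃ := hconn.dist_triangle (u := b') (v := b) (w := z)
    have t₄ := hconn.dist_triangle (u := y) (v := b') (w := z)
    have hIH := ih (a := a') (b := b') ⟨by omega, ha'⟩ ⟨by omega, hb'⟩ (by omega)
    have t₅ := hconn.dist_triangle (u := a') (v := a) (w := b)
    have t₆ := hconn.dist_triangle (u := a) (v := a') (w := b)
    have t₇ := hconn.dist_triangle (u := a') (v := b') (w := b)
    have c₁ := G.dist_comm (u := a) (v := a')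
    have c₂ := G.dist_comm (u := b) (v := a)
    have c₃ := G.dist_comm (u := b) (v := a')
    have c₄ := G.dist_comm (u := z) (v := x)
    have c₅ := G.dist_comm (u := z) (v := b)
    have c₆ := G.dist_comm (u := x) (v := a')
    have n₁ : G.dist a' b ≠ G.dist a b + 1 := fun h => by
      have := halpha.dist_add_dist_le (u := y) haa (by omega) h
      omega
    have n₂ : G.dist a b ≠ G.dist a' b + 1 := fun h => by
      have h₁ := halpha.dist_add_dist_le (u := b) (x := x) haa (by omega) (by omega)
      have h₂ := halpha.dist_le_of_mem_interval hconn (x := x) (p := G.dist a x) hb₁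
        (by omega) (by omega)
      omega
    have h₁ := halpha.dist_add_dist_le (u := a') (x := z) hbb (by omega) (by omega)
    have h₂ := halpha.dist_le_of_mem_interval hconn (y := y) (z := x) (b := a') (x := z)
      (p := G.dist b' z) (by omega) (by omega) (by omega)
    omega

/-- All geodesic triangles in an `α_i`-metric graph are `3(i+1)`-thin, in slice
form: with `k = ⌊(x|z)_y⌋ = ⌊(d(x,y) + d(y,z) - d(x,z)) / 2⌋` (here computed
with truncated subtraction and division on `ℕ`), every `z' ∈ S_k(y,x)` and
`x' ∈ S_k(y,z)` satisfy `d(z',x') ≤ 3(i+1)`. -/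
theorem stmt7 {V : Type*} [Fintype V] (G : SimpleGraph V) (hconn : G.Connected)
    (i : ℕ) (halpha : alphaMetric G i) (x y z : V) (k : ℕ)
    (hks : k = (G.dist x y + G.dist y z - G.dist x z) / 2)
    (z' x' : V) (hz' : inSlice G y x k z') (hx' : inSlice G y z k x') :
    G.dist z' x' ≤ 3 * (i + 1) := by
  have h₁ := hz'.1
  have h₂ := hx'.1
  have h₃ := hz'.2
  have h₄ := hx'.2
  have c₁ := G.dist_comm (u := x) (v := y)
  have t₁ := hconn.dist_triangle (u := x) (v := y) (w := z)
  exact halpha.dist_le_of_inSlice_of_inSlice hconn k hz' hx' (by omega)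
end

section
/- For every integer p ≥ 2 there exists an α_2-metric graph G_p with exactly 4p vertices containing a metric triangle x, y, z with d(x,y) = d(x,z) = p and d(y,z) = 2. In particular, there is no constant upper bound on the side-length of metric triangles in α_2-metric graphs. -/
/-- The open interval `I^o(u,v) = I(u,v) \ {u,v}`. -/
def openInterval {V : Type*} (G : SimpleGraph V) (u v : V) : Set V :=
  {t | G.dist u t + G.dist t v = G.dist u v ∧ t ≠ u ∧ t ≠ v}

/-- `u, v, w` form a metric triangle: the open intervals `I^o(u,v)`, `I^o(v,w)`,
`I^o(w,u)` are pairwise disjoint. -/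
def metricTriangle {V : Type*} (G : SimpleGraph V) (u v w : V) : Prop :=
  Disjoint (openInterval G u v) (openInterval G v w) ∧
  Disjoint (openInterval G v w) (openInterval G w u) ∧
  Disjoint (openInterval G w u) (openInterval G u v)

/-- The vertices of `braidGraph p`: for `1 ≤ l ≤ p` two side vertices in layer `l`, for
`1 ≤ l ≤ p - 1` two hub vertices in layer `l`, one vertex in layer `0` and one in layer `p + 1`. -/
inductive BraidVertex (p : ℕ) : Type
  | bottom : BraidVertex p
  | top : BraidVertex p
  | side (s : Bool) (i : Fin p) : BraidVertex p
  | hub (s : Bool) (i : Fin (p - 1)) : BraidVertex p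

namespace BraidVertex

variable {p : ℕ}

/-- Braid vertices as a sum type. -/
def equivSum (p : ℕ) : BraidVertex p ≃ Bool ⊕ (Bool × Fin p) ⊕ (Bool × Fin (p - 1)) where
  toFun
    | bottom => .inl false
    | top => .inl true
    | side s i => .inr (.inl (s, i))
    | hub s i => .inr (.inr (s, i))
  invFun
    | .inl false => bottom
    | .inl true => top
    | .inr (.inl (s, i)) => side s i
    | .inr (.inr (s, i)) => hub s i
  left_inv v := by cases v <;> rfl
  right_inv v := by rcases v with (_ | _) | _ | _ <;> rfl

instance : Fintype (BraidVertex p) := Fintype.ofEquiv _ (equivSum p).symm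

theorem card_eq (hp : 1 ≤ p) : Fintype.card (BraidVertex p) = 4 * p := by
  rw [Fintype.card_congr (equivSum p)]
  simp
  omega

/-- The layer of a vertex. -/
def layer : BraidVertex p → ℕ
  | bottom => 0
  | top => p + 1
  | side _ i => i + 1
  | hub _ i => i + 1

/-- The excess of the distance over the layer difference, from a lower to a higher vertex. -/
def excess : BraidVertex p → BraidVertex p → ℕ
  | bottom, hub _ _ => 1
  | side s _, side t _ => if s = t then 0 else 1
  | side _ _, hub _ _ => 1
  | _, _ => 0

/-- The distance between two vertices in the same layer. -/
def sameLayerDist : BraidVertex p → BraidVertex p → ℕ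
  | side s _, side t _ => if s = t then 0 else 2
  | side s _, hub t _ => if s = t then 1 else 2
  | hub s _, side t _ => if s = t then 1 else 2
  | hub s _, hub t _ => if s = t then 0 else 1
  | _, _ => 0

/-- The distance function of `braidGraph p`. -/
def braidDist (u v : BraidVertex p) : ℕ :=
  if layer u < layer v then layer v - layer u + excess u v
  else if layer v < layer u then layer u - layer v + excess v u
  else sameLayerDist u v

theorem braidDist_comm (u v : BraidVertex p) : braidDist u v = braidDist v u := by
  have h : sameLayerDist u v = sameLayerDist v u := by
    rcases u with _ | _ | ⟨_ | _, _⟩ | ⟨_ | _, _⟩ <;>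
    rcases v with _ | _ | ⟨_ | _, _⟩ | ⟨_ | _, _⟩ <;> rfl
  unfold braidDist
  split_ifs <;> first | rfl | assumption | omega

theorem braidDist_self (u : BraidVertex p) : braidDist u u = 0 := by
  cases u <;> simp [braidDist, sameLayerDist]

end BraidVertex

open BraidVertex

/-- A braid of two paths whose layers are joined through hubs. -/
def braidGraph (p : ℕ) : SimpleGraph (BraidVertex p) where
  Adj u v := braidDist u v = 1
  symm := ⟨fun u v h => by rwa [braidDist_comm]⟩
  loopless := ⟨fun u h => by simp [braidDist_self] at h⟩

theorem SimpleGraph.connected_and_dist_eq {V : Type*} [Nonempty V] (G : SimpleGraph V)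
    (D : V → V → ℕ) (hself : ∀ v, D v v = 0)
    (hadj : ∀ u v w, G.Adj v w → D u w ≤ D u v + 1)
    (hstep : ∀ u v, u ≠ v → ∃ w, G.Adj w v ∧ D u w + 1 = D u v) :
    G.Connected ∧ ∀ u v, G.dist u v = D u v := by
  have hwalk : ∀ n u v, D u v = n → ∃ q : G.Walk u v, q.length = n := by
    intro n
    induction n with
    | zero =>
      intro u v h
      by_cases huv : u = v
      · subst huv; exact ⟨.nil, rfl⟩
      · obtain ⟨w, -, hw⟩ := hstep u v huv
        omega
    | succ n ih =>
      intro u v h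
      have huv : u ≠ v := by rintro rfl; simp [hself] at h
      obtain ⟨w, hwv, hw⟩ := hstep u v huv
      obtain ⟨q, hq⟩ := ih u w (by omega)
      exact ⟨q.concat hwv, by simp [hq]⟩
  have hle : ∀ u v w (q : G.Walk v w), D u w ≤ D u v + q.length := by
    intro u v w q
    induction q with
    | nil => simp
    | cons h q ih =>
      have := hadj u _ _ h
      simp only [SimpleGraph.Walk.length_cons]
      omega
  have hconn : G.Connected := ⟨fun u v => ⟨(hwalk _ u v rfl).choose⟩⟩
  refine ⟨hconn, fun u v => le_antisymm ?_ ?_⟩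
  · obtain ⟨q, hq⟩ := hwalk _ u v rfl
    exact hq ▸ G.dist_le q
  · obtain ⟨q, hq⟩ := hconn.exists_walk_length_eq_dist u v
    have := hle u u v q
    rw [hself] at this
    omega

namespace BraidVertex

variable {p : ℕ}

theorem excess_le_one (u v : BraidVertex p) : excess u v ≤ 1 := by
  rcases u with _ | _ | ⟨_ | _, _⟩ | ⟨_ | _, _⟩ <;>
  rcases v with _ | _ | ⟨_ | _, _⟩ | ⟨_ | _, _⟩ <;> simp [excess]

theorem sameLayerDist_le_two (u v : BraidVertex p) : sameLayerDist u v ≤ 2 := by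
  rcases u with _ | _ | ⟨_ | _, _⟩ | ⟨_ | _, _⟩ <;>
  rcases v with _ | _ | ⟨_ | _, _⟩ | ⟨_ | _, _⟩ <;> simp [sameLayerDist]

theorem eq_of_sameLayerDist_eq_zero (u v : BraidVertex p) (hl : layer u = layer v)
    (h : sameLayerDist u v = 0) : u = v := by
  rcases u with _ | _ | ⟨_ | _, _, _⟩ | ⟨_ | _, _, _⟩ <;>
  rcases v with _ | _ | ⟨_ | _, _, _⟩ | ⟨_ | _, _, _⟩ <;>
  simp [sameLayerDist, layer] at h hl ⊢ <;> omega

theorem excess_eq_one_of_fork (u v w x : BraidVertex p)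
    (hvu : excess v u = 0) (hvw : excess v w = 0) (huw : sameLayerDist u w = 2)
    (hwx : excess w x = 1) (hvx : excess v x = 1) : excess u x = 1 := by
  rcases v with _ | _ | ⟨_ | _, _⟩ | ⟨_ | _, _⟩ <;>
  rcases x with _ | _ | ⟨_ | _, _⟩ | ⟨_ | _, _⟩ <;> simp [excess] at hvx <;>
  rcases w with _ | _ | ⟨_ | _, _⟩ | ⟨_ | _, _⟩ <;> simp [excess] at hvw hwx <;>
  rcases u with _ | _ | ⟨_ | _, _⟩ | ⟨_ | _, _⟩ <;>
  simp [excess, sameLayerDist] at hvu huw ⊢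

theorem excess_eq_one_of_cofork (u v w x : BraidVertex p)
    (hxw : excess x w = 0) (hvw : excess v w = 0) (hvx : sameLayerDist v x = 2)
    (huv : excess u v = 1) (huw : excess u w = 1) : excess u x = 1 := by
  rcases u with _ | _ | ⟨_ | _, _⟩ | ⟨_ | _, _⟩ <;>
  rcases v with _ | _ | ⟨_ | _, _⟩ | ⟨_ | _, _⟩ <;> simp [excess] at huv <;>
  rcases w with _ | _ | ⟨_ | _, _⟩ | ⟨_ | _, _⟩ <;> simp [excess] at hvw huw <;>
  rcases x with _ | _ | ⟨_ | _, _⟩ | ⟨_ | _, _⟩ <;>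
  simp [excess, sameLayerDist] at hxw hvx ⊢

theorem not_excess_alternating_below (u v w x : BraidVertex p) (hvw : sameLayerDist v w = 1)
    (huv : excess u v = 0) (huw : excess u w = 1) (hxw : excess x w = 0)
    (hxv : excess x v = 1) : False := by
  rcases v with _ | _ | ⟨_ | _, _⟩ | ⟨_ | _, _⟩ <;>
  rcases w with _ | _ | ⟨_ | _, _⟩ | ⟨_ | _, _⟩ <;> simp [sameLayerDist] at hvw <;>
  rcases u with _ | _ | ⟨_ | _, _⟩ | ⟨_ | _, _⟩ <;> simp [excess] at huv huw <;>
  rcases x with _ | _ | ⟨_ | _, _⟩ | ⟨_ | _, _⟩ <;> simp [excess] at hxw hxv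

theorem not_excess_alternating_above (u v w x : BraidVertex p) (hvw : sameLayerDist v w = 1)
    (hvu : excess v u = 0) (hwu : excess w u = 1) (hwx : excess w x = 0)
    (hvx : excess v x = 1) : False := by
  rcases v with _ | _ | ⟨_ | _, _⟩ | ⟨_ | _, _⟩ <;>
  rcases w with _ | _ | ⟨_ | _, _⟩ | ⟨_ | _, _⟩ <;> simp [sameLayerDist] at hvw <;>
  rcases u with _ | _ | ⟨_ | _, _⟩ | ⟨_ | _, _⟩ <;> simp [excess] at hvu hwu <;>
  rcases x with _ | _ | ⟨_ | _, _⟩ | ⟨_ | _, _⟩ <;> simp [excess] at hwx hvx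

theorem braidDist_cases (u v : BraidVertex p) :
    (layer u < layer v ∧ braidDist u v = layer v - layer u + excess u v ∧ excess u v ≤ 1) ∨
    (layer v < layer u ∧ braidDist u v = layer u - layer v + excess v u ∧ excess v u ≤ 1) ∨
    (layer u = layer v ∧ braidDist u v = sameLayerDist u v ∧ sameLayerDist u v ≤ 2) := by
  have := excess_le_one u v
  have := excess_le_one v u
  have := sameLayerDist_le_two u v
  unfold braidDist
  split_ifs <;> omega

theorem eq_of_braidDist_eq_zero (u v : BraidVertex p) (h : braidDist u v = 0) : u = v := by
  have := eq_of_sameLayerDist_eq_zero u v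
  rcases braidDist_cases u v with h' | h' | h'
  · omega
  · omega
  · exact this h'.1 (by omega)

set_option maxHeartbeats 1000000 in
theorem braidDist_alpha_of_layer_le (u v w x : BraidVertex p)
    (huw : braidDist u v + braidDist v w = braidDist u w)
    (hvx : braidDist v w + braidDist w x = braidDist v x) (hvw : braidDist v w = 1)
    (hl : layer v ≤ layer w) :
    braidDist u v + braidDist v x ≤ braidDist u x + 2 := by
  by_contra! hc
  rcases braidDist_cases v w with h₁ | h₁ | h₁ <;> (try (exfalso; omega)) <;>
  rcases braidDist_cases u w with h₂ | h₂ | h₂ <;> (try (exfalso; omega)) <;>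
  rcases braidDist_cases u v with h₃ | h₃ | h₃ <;> (try (exfalso; omega)) <;>
  rcases braidDist_cases v x with h₄ | h₄ | h₄ <;> (try (exfalso; omega)) <;>
  rcases braidDist_cases w x with h₅ | h₅ | h₅ <;> (try (exfalso; omega)) <;>
  rcases braidDist_cases u x with h₆ | h₆ | h₆ <;> (try (exfalso; omega)) <;>
  first
  | exact not_excess_alternating_below u v w x (by omega) (by omega) (by omega) (by omega)
      (by omega)
  | exact not_excess_alternating_above u v w x (by omega) (by omega) (by omega) (by omega)
      (by omega)
  | have := excess_eq_one_of_fork u v w x (by omega) (by omega) (by omega) (by omega) (by omega)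
    omega
  | have := excess_eq_one_of_cofork u v w x (by omega) (by omega) (by omega) (by omega) (by omega)
    omega
  | have := eq_of_braidDist_eq_zero u x (by omega)
    subst this
    rw [braidDist_comm w u] at *
    omega

theorem braidDist_alpha (u v w x : BraidVertex p)
    (huw : braidDist u v + braidDist v w = braidDist u w)
    (hvx : braidDist v w + braidDist w x = braidDist v x) (hvw : braidDist v w = 1) :
    braidDist u v + braidDist v x ≤ braidDist u x + 2 := by
  rcases le_total (layer v) (layer w) with hl | hl
  · exact braidDist_alpha_of_layer_le u v w x huw hvx hvw hl
  · have := braidDist_alpha_of_layer_le x w v u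
    simp only [braidDist_comm x, braidDist_comm w v, braidDist_comm w u,
      braidDist_comm v u] at this
    omega

set_option maxHeartbeats 4000000 in
theorem braidDist_le_of_adj (u v w : BraidVertex p) (h : braidDist v w = 1) :
    braidDist u w ≤ braidDist u v + 1 := by
  rcases v with _ | _ | ⟨_ | _, i, hi⟩ | ⟨_ | _, i, hi⟩ <;>
  rcases w with _ | _ | ⟨_ | _, j, hj⟩ | ⟨_ | _, j, hj⟩ <;>
  simp [braidDist, layer, excess, sameLayerDist] at h <;>
  rcases u with _ | _ | ⟨_ | _, k, hk⟩ | ⟨_ | _, k, hk⟩ <;>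
  simp [braidDist, layer, excess, sameLayerDist] <;> grind

set_option maxHeartbeats 1000000 in
/-- Every vertex `v ≠ u` has a neighbour that is closer to `u`. -/
theorem exists_adj_braidDist_succ (hp : 2 ≤ p) (u v : BraidVertex p) (huv : u ≠ v) :
    ∃ w, braidDist w v = 1 ∧ braidDist u w + 1 = braidDist u v := by
  have key : ∀ w : BraidVertex p, braidDist w v = 1 → braidDist u w + 1 = braidDist u v →
      ∃ w, braidDist w v = 1 ∧ braidDist u w + 1 = braidDist u v := fun w h h' => ⟨w, h, h'⟩
  by_cases hadj : braidDist u v = 1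
  · exact key u hadj (by rw [braidDist_self, hadj])
  rcases u with _ | _ | ⟨s, i, hi⟩ | ⟨s, i, hi⟩ <;>
  rcases v with _ | _ | ⟨t, j, hj⟩ | ⟨t, j, hj⟩
  · exact absurd rfl huv
  · refine key (side true ⟨p - 1, by omega⟩) ?_ ?_ <;> (simp [braidDist, layer, excess, sameLayerDist] at hadj huv ⊢ <;> grind)
  · rcases j with _ | j
    · refine key bottom ?_ ?_ <;> (simp [braidDist, layer, excess, sameLayerDist] at hadj huv ⊢ <;> grind)
    · refine key (side t ⟨j, by omega⟩) ?_ ?_ <;> (simp [braidDist, layer, excess, sameLayerDist] at hadj huv ⊢ <;> grind)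
  · refine key (side t ⟨j, by omega⟩) ?_ ?_ <;> (simp [braidDist, layer, excess, sameLayerDist] at hadj huv ⊢ <;> grind)
  · refine key (side true ⟨0, by omega⟩) ?_ ?_ <;> (simp [braidDist, layer, excess, sameLayerDist] at hadj huv ⊢ <;> grind)
  · exact absurd rfl huv
  · by_cases h : j + 1 < p
    · refine key (side t ⟨j + 1, h⟩) ?_ ?_ <;> (simp [braidDist, layer, excess, sameLayerDist] at hadj huv ⊢ <;> grind)
    · refine key top ?_ ?_ <;> (simp [braidDist, layer, excess, sameLayerDist] at hadj huv ⊢ <;> grind)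
  · refine key (side t ⟨j + 1, by omega⟩) ?_ ?_ <;> (simp [braidDist, layer, excess, sameLayerDist] at hadj huv ⊢ <;> grind)
  · refine key (side s ⟨0, by omega⟩) ?_ ?_ <;> (simp [braidDist, layer, excess, sameLayerDist] at hadj huv ⊢ <;> grind)
  · refine key (side s ⟨p - 1, by omega⟩) ?_ ?_ <;> (simp [braidDist, layer, excess, sameLayerDist] at hadj huv ⊢ <;> grind)
  · by_cases hst : s = t
    · subst hst
      rcases lt_trichotomy i j with h | h | h
      · refine key (side s ⟨j - 1, by omega⟩) ?_ ?_ <;> (simp [braidDist, layer, excess, sameLayerDist] at hadj huv ⊢ <;> grind)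
      · exact absurd (by simp [h]) huv
      · refine key (side s ⟨j + 1, by omega⟩) ?_ ?_ <;> (simp [braidDist, layer, excess, sameLayerDist] at hadj huv ⊢ <;> grind)
    · rcases lt_trichotomy i j with h | h | h
      · refine key (hub s ⟨j - 1, by omega⟩) ?_ ?_ <;> (simp [braidDist, layer, excess, sameLayerDist] at hadj huv ⊢ <;> grind)
      · rcases j with _ | j
        · refine key bottom ?_ ?_ <;> (simp [braidDist, layer, excess, sameLayerDist] at hadj huv ⊢ <;> grind)
        · refine key (hub s ⟨j, by omega⟩) ?_ ?_ <;> (simp [braidDist, layer, excess, sameLayerDist] at hadj huv ⊢ <;> grind)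
      · refine key (hub t ⟨j, by omega⟩) ?_ ?_ <;> (simp [braidDist, layer, excess, sameLayerDist] at hadj huv ⊢ <;> grind)
  · rcases lt_trichotomy i j with h | h | h
    · refine key (hub s ⟨j - 1, by omega⟩) ?_ ?_ <;> (simp [braidDist, layer, excess, sameLayerDist] at hadj huv ⊢ <;> grind)
    · refine key (hub s ⟨j, by omega⟩) ?_ ?_ <;> (simp [braidDist, layer, excess, sameLayerDist] at hadj huv ⊢ <;> grind)
    · refine key (side s ⟨j + 1, by omega⟩) ?_ ?_ <;> (simp [braidDist, layer, excess, sameLayerDist] at hadj huv ⊢ <;> grind)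
  · refine key (side s ⟨0, by omega⟩) ?_ ?_ <;> (simp [braidDist, layer, excess, sameLayerDist] at hadj huv ⊢ <;> grind)
  · refine key (side true ⟨p - 1, by omega⟩) ?_ ?_ <;> (simp [braidDist, layer, excess, sameLayerDist] at hadj huv ⊢ <;> grind)
  · rcases lt_trichotomy i j with h | h | h
    · refine key (hub s ⟨j - 1, by omega⟩) ?_ ?_ <;> (simp [braidDist, layer, excess, sameLayerDist] at hadj huv ⊢ <;> grind)
    · refine key (hub t ⟨j, by omega⟩) ?_ ?_ <;> (simp [braidDist, layer, excess, sameLayerDist] at hadj huv ⊢ <;> grind)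
    · refine key (hub t ⟨j, by omega⟩) ?_ ?_ <;> (simp [braidDist, layer, excess, sameLayerDist] at hadj huv ⊢ <;> grind)
  · rcases lt_trichotomy i j with h | h | h
    · refine key (hub s ⟨j - 1, by omega⟩) ?_ ?_ <;> (simp [braidDist, layer, excess, sameLayerDist] at hadj huv ⊢ <;> grind)
    · refine key (hub s ⟨i, by omega⟩) ?_ ?_ <;> (simp [braidDist, layer, excess, sameLayerDist] at hadj huv ⊢ <;> grind)
    · refine key (hub s ⟨j + 1, by omega⟩) ?_ ?_ <;> (simp [braidDist, layer, excess, sameLayerDist] at hadj huv ⊢ <;> grind)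

end BraidVertex

theorem braidGraph_connected_and_dist (p : ℕ) (hp : 2 ≤ p) :
    (braidGraph p).Connected ∧ ∀ u v, (braidGraph p).dist u v = braidDist u v :=
  haveI : Nonempty (BraidVertex p) := ⟨bottom⟩
  SimpleGraph.connected_and_dist_eq _ _ braidDist_self
    (fun u v w h => braidDist_le_of_adj u v w h) (exists_adj_braidDist_succ hp)

/-- For every `p ≥ 2`, there is an `α_2`-metric (connected, finite) graph with
exactly `4p` vertices containing a metric triangle `x, y, z` with
`d(x,y) = d(x,z) = p` and `d(y,z) = 2`. Hence there is no constant upper bound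
on the side-length of metric triangles in `α_2`-metric graphs. -/
theorem stmt8 (p : ℕ) (hp : 2 ≤ p) :
    ∃ (V : Type) (_ : Fintype V) (G : SimpleGraph V),
      Fintype.card V = 4 * p ∧ G.Connected ∧ alphaMetric G 2 ∧
      ∃ x y z : V, metricTriangle G x y z ∧
        G.dist x y = p ∧ G.dist x z = p ∧ G.dist y z = 2 := by
  obtain ⟨hconn, hdist⟩ := braidGraph_connected_and_dist p hp
  refine ⟨BraidVertex p, inferInstance, braidGraph p, card_eq (by omega), hconn, ?_,
    bottom, side false ⟨p - 1, by omega⟩, side true ⟨p - 1, by omega⟩, ?_, ?_, ?_, ?_⟩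
  · intro u v w x huw hvx hvw
    simp only [hdist] at *
    exact braidDist_alpha u v w x huw hvx hvw
  · refine ⟨?_, ?_, ?_⟩ <;> rw [Set.disjoint_left] <;> rintro w ⟨h, h₁, h₂⟩ ⟨h', h₃, h₄⟩ <;>
    rw [hdist, hdist, hdist] at h h' <;>
    rcases w with _ | _ | ⟨_ | _, i, hi⟩ | ⟨_ | _, i, hi⟩ <;>
    simp [braidDist, layer, excess, sameLayerDist] at h h' h₁ h₂ h₃ h₄ <;> grind
  all_goals
    rw [hdist]
    simp [braidDist, layer, excess, sameLayerDist]
    try omega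
end

section
/- Let G be an α_1-metric graph, and let D(u,r_u), D(v,r_v), D(w,r_w) be pairwise intersecting disks of G such that d(u,v) = r_u + r_v. Then every vertex x ∈ S_{r_u}(u,v) satisfies d(w,x) ≤ r_w + 2. -/
/-- In a connected graph, every vertex `p ≠ q` has a neighbour one step closer to `q`. -/
theorem exists_adj_dist_succ {V : Type*} {G : SimpleGraph V} (hconn : G.Connected) {p q : V}
    (h : 0 < G.dist p q) : ∃ r, G.Adj p r ∧ G.dist r q + 1 = G.dist p q := by
  obtain ⟨W, hW⟩ := hconn.exists_walk_length_eq_dist p q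
  cases W with
  | nil => simp at h
  | @cons _ r _ hadj W =>
    refine ⟨r, hadj, ?_⟩
    have h1 := SimpleGraph.dist_le W
    have h2 := hconn.dist_triangle (u := p) (v := r) (w := q)
    have h3 := SimpleGraph.dist_eq_one_iff_adj.mpr hadj
    rw [SimpleGraph.Walk.length_cons] at hW
    omega

/-- If `p` is far from lying between `w` and `u`, stepping from `p` towards `w` does not increase
the distance to `u`. -/
theorem alphaMetric.dist_le_of_adj_of_excess {V : Type*} {G : SimpleGraph V}
    (hconn : G.Connected) (halpha : alphaMetric G 1) {w u p q : V}
    (hp : G.dist w u + 2 ≤ G.dist w p + G.dist p u) (hadj : G.Adj p q)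
    (hq : G.dist w q + 1 = G.dist w p) : G.dist q u ≤ G.dist p u := by
  by_contra! hlt
  have h1 := SimpleGraph.dist_eq_one_iff_adj.mpr hadj.symm
  have h2 := hconn.dist_triangle (u := q) (v := p) (w := u)
  have := halpha w q p u (by omega) (by omega) hadj.symm
  omega

/-- A vertex of `I(u,v)` has excess at most `2` over one of the pairs `(w,u)` and `(w,v)`. -/
theorem alphaMetric.excess_le_of_mem_interval {V : Type*} {G : SimpleGraph V}
    (hconn : G.Connected) (halpha : alphaMetric G 1) {u v w x : V}
    (hx : G.dist u x + G.dist x v = G.dist u v)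
    (hu : G.dist w u + 3 ≤ G.dist w x + G.dist x u) :
    G.dist w x + G.dist x v ≤ G.dist w v + 2 := by
  by_contra! hv
  have tri (a b c : V) := hconn.dist_triangle (u := a) (v := b) (w := c)
  have comm (a b : V) := SimpleGraph.dist_comm (G := G) (u := a) (v := b)
  have one {a b : V} (h : G.Adj a b) := SimpleGraph.dist_eq_one_iff_adj.mpr h
  have step {t p q : V} := halpha.dist_le_of_adj_of_excess hconn (w := w) (u := t) (p := p) (q := q)
  obtain ⟨x₁, hx₁, hd₁⟩ := exists_adj_dist_succ hconn (p := x) (q := u)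
    (by have := tri w x u; have := tri w u x; have := comm u x; omega)
  obtain ⟨x₂, hx₂, hd₂⟩ := exists_adj_dist_succ hconn (p := x) (q := v)
    (by have := tri w v x; have := comm v x; omega)
  have e₁ := one hx₁
  have e₂ := one hx₂
  have cux := comm u x
  have cux₁ := comm u x₁
  have cux₂ := comm u x₂
  have c₁ := comm x₁ x
  have c₂ := comm x₂ x
  have hv₁ : G.dist x₁ v = G.dist x v + 1 := by
    have := tri u x₁ v; have := tri x₁ x v; omega
  have hu₂ : G.dist x₂ u = G.dist x u + 1 := by
    have := tri u x₂ v; have := tri x₂ x u; omega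
  have hw₁ : G.dist w x₁ = G.dist w x := by
    have := tri w x x₁
    have := tri w x₁ x
    have h1 := mt (step (t := v) (by omega) hx₁) (by omega)
    by_contra hne
    have := step (t := u) (p := x₁) (q := x) (by omega) hx₁.symm (by omega)
    omega
  have hw₂ : G.dist w x₂ = G.dist w x := by
    have := tri w x x₂
    have := tri w x₂ x
    have h1 := mt (step (t := u) (by omega) hx₂) (by omega)
    by_contra hne
    have := step (t := v) (p := x₂) (q := x) (by omega) hx₂.symm (by omega)
    omega
  have h12 : G.dist x₁ x₂ = 2 := by
    have := tri x₁ x x₂; have := tri x₂ x₁ u; have := comm x₁ x₂; omega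
  obtain ⟨y, hy, hyw⟩ := exists_adj_dist_succ hconn (p := x₁) (q := w)
    (by have := tri w v x; have := comm v x; have := comm x₁ w; have := tri w x v
        have := tri w u x; have := tri u w x; have := comm u w; omega)
  have cw₁ := comm x₁ w
  have cwy := comm y w
  have ey := one hy
  have cy₁ := comm y x₁
  have hyu := step (t := u) (by omega) hy (by omega)
  have hyv := step (t := v) (by omega) hy (by omega)
  have cuy := comm u y
  have huyv := tri u y v
  have cy₂ := comm y x₂
  have hy₂ : G.dist y x₂ = 2 := by
    have := tri y x₁ x₂
    have := tri x₂ y u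
    by_contra hne
    have := halpha w y x₁ x₂ (by omega) (by omega) hy.symm
    omega
  obtain ⟨m, hm, hm₂⟩ := exists_adj_dist_succ hconn (p := y) (q := x₂) (by omega)
  have hadj : G.Adj m x₂ := SimpleGraph.dist_eq_one_iff_adj.mp (by omega)
  have em := one hm
  have hmv : G.dist m v = G.dist x v := by
    have := tri m x₂ v; have := tri y m v; omega
  have := tri w y m
  have := tri w m x₂
  rcases (by omega : G.dist w m = G.dist w x ∨ G.dist w m + 1 = G.dist w x) with h | h
  · have := step (t := v) (p := m) (q := y) (by omega) hm.symm (by omega)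
    omega
  · have := step (t := v) (p := x₂) (q := m) (by omega) hadj.symm (by omega)
    omega

theorem stmt10 {V : Type*} [Fintype V] (G : SimpleGraph V) (hconn : G.Connected)
    (halpha : alphaMetric G 1) (u v w : V) (ru rv rw : ℕ)
    (hd : G.dist u v = ru + rv)
    (huv : ∃ a, G.dist u a ≤ ru ∧ G.dist v a ≤ rv)
    (huw : ∃ a, G.dist u a ≤ ru ∧ G.dist w a ≤ rw)
    (hvw : ∃ a, G.dist v a ≤ rv ∧ G.dist w a ≤ rw)
    (x : V) (hx : inSlice G u v ru x) :
    G.dist w x ≤ rw + 2 := by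
  have hdist {t : V} {r : ℕ} (h : ∃ a, G.dist t a ≤ r ∧ G.dist w a ≤ rw) :
      G.dist w t ≤ rw + r := by
    obtain ⟨a, h1, h2⟩ := h
    have := hconn.dist_triangle (u := w) (v := a) (w := t)
    have := SimpleGraph.dist_comm (G := G) (u := a) (v := t)
    omega
  have hwu := hdist huw
  have hwv := hdist hvw
  obtain ⟨h1, h2⟩ := hx
  have := SimpleGraph.dist_comm (G := G) (u := u) (v := x)
  by_contra! hlt
  have := halpha.excess_le_of_mem_interval hconn (w := w) h1 (by omega)
  omega
end

section
/- Let G be an α_1-metric graph, let r_u, r_v, r_a, r_b be nonnegative integers, and let u, v, a, b be vertices of G such that d(u,v) = r_u + r_v, d(u,a) ≤ r_u + r_a, d(v,a) ≤ r_v + r_a, d(u,b) ≤ r_u + r_b, and d(v,b) ≤ r_v + r_b. Then d(a,b) ≤ r_a + r_b + 2. -/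
namespace AlphaMetric

variable {V : Type*} {G : SimpleGraph V}

section Basic

lemma dist_adj_bounds (hc : G.Connected) {p q : V} (h : G.Adj p q) (t : V) :
    G.dist t p ≤ G.dist t q + 1 ∧ G.dist t q ≤ G.dist t p + 1 := by
  have h1 : G.dist p q = 1 := SimpleGraph.dist_eq_one_iff_adj.2 h
  have h2 : G.dist q p = 1 := SimpleGraph.dist_eq_one_iff_adj.2 h.symm
  have h3 : G.dist t p ≤ G.dist t q + G.dist q p := hc.dist_triangle
  have h4 : G.dist t q ≤ G.dist t p + G.dist p q := hc.dist_triangle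
  omega

lemma dist_le_anchors (hc : G.Connected) (u v x : V) :
    G.dist u v ≤ G.dist u x + G.dist v x := by
  have h : G.dist u v ≤ G.dist u x + G.dist x v := hc.dist_triangle
  rwa [G.dist_comm (u := x)] at h

lemma exists_adj_dist_succ (hc : G.Connected) {t x : V} (h : 0 < G.dist t x) :
    ∃ w, G.Adj x w ∧ G.dist t w + 1 = G.dist t x := by
  obtain ⟨p, hp⟩ := hc.exists_walk_length_eq_dist x t
  rw [G.dist_comm] at hp
  cases p with
  | nil => simp at h
  | @cons _ w _ hadj q =>
    refine ⟨w, hadj, ?_⟩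
    have h1 := SimpleGraph.dist_le q
    rw [G.dist_comm] at h1
    have h2 := dist_adj_bounds hc hadj t
    simp only [SimpleGraph.Walk.length_cons] at hp
    omega

lemma dist_eq_two (hc : G.Connected) {p m q : V} (h1 : G.Adj p m) (h2 : G.Adj m q)
    (hne : p ≠ q) (hn : ¬ G.Adj p q) : G.dist p q = 2 := by
  have h3 := (dist_adj_bounds hc h2 p).2
  have h4 : G.dist p m = 1 := SimpleGraph.dist_eq_one_iff_adj.2 h1
  have h5 : G.dist p q ≠ 1 := fun h => hn (SimpleGraph.dist_eq_one_iff_adj.1 h)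
  have h6 := hc.pos_dist_of_ne hne
  omega

lemma exists_mid (hc : G.Connected) {p q : V} (h : G.dist p q = 2) :
    ∃ m, G.Adj p m ∧ G.Adj m q := by
  obtain ⟨m, h1, h2⟩ := exists_adj_dist_succ hc (t := p) (x := q) (by omega)
  exact ⟨m, SimpleGraph.dist_eq_one_iff_adj.1 (by omega), h1.symm⟩

/-- The `α₁`-property for an edge `pq` that is traversed away from `u` and towards `x`. -/
lemma dist_add_le (ha : alphaMetric G 1) {u x p q : V} (h : G.Adj p q)
    (hu : G.dist u q = G.dist u p + 1) (hx : G.dist x p = G.dist x q + 1) :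
    G.dist u p + G.dist x p ≤ G.dist u x + 1 := by
  have h1 : G.dist p q = 1 := SimpleGraph.dist_eq_one_iff_adj.2 h
  have := ha u p q x (by omega)
    (by rw [G.dist_comm (u := q), G.dist_comm (u := p) (v := x)]; omega) h
  rwa [G.dist_comm (u := p)] at this

lemma adj_of_common_far (hc : G.Connected) (ha : alphaMetric G 1) {b x p q : V}
    (hp : G.Adj x p) (hq : G.Adj x q) (hbp : G.dist b p + 1 = G.dist b x)
    (hbq : G.dist b q + 1 = G.dist b x) (hne : p ≠ q) : G.Adj p q := by
  by_contra hn
  have h2 := dist_eq_two hc hp.symm hq hne hn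
  rw [G.dist_comm] at h2
  have h1 : G.dist q x = 1 := SimpleGraph.dist_eq_one_iff_adj.2 hq.symm
  have := dist_add_le ha (u := b) (x := q) hp.symm (by omega) (by omega)
  omega

lemma dist_mid_le (hc : G.Connected) (ha : alphaMetric G 1) {u p m q : V} {k : ℕ}
    (h1 : G.Adj p m) (h2 : G.Adj m q) (hne : p ≠ q) (hn : ¬ G.Adj p q)
    (hp : G.dist u p ≤ k) (hq : G.dist u q ≤ k) : G.dist u m ≤ k := by
  by_contra hk
  have h3 := dist_eq_two hc h1 h2 hne hn
  rw [G.dist_comm] at h3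
  have h4 : G.dist q m = 1 := SimpleGraph.dist_eq_one_iff_adj.2 h2.symm
  have h5 := dist_adj_bounds hc h1 u
  have := dist_add_le ha (u := u) (x := q) h1 (by omega) (by omega)
  omega

lemma adj_diag_of_four_cycle (hc : G.Connected) (ha : alphaMetric G 1) {c s q e : V}
    (h1 : G.Adj c s) (h2 : G.Adj s q) (h3 : G.Adj q e) (h4 : G.Adj e c)
    (hcq : c ≠ q) (hes : e ≠ s) (hn : ¬ G.Adj c q) : G.Adj e s := by
  by_contra hn'
  have d1 := dist_eq_two hc h4 h1 hes hn'
  have d2 := dist_eq_two hc h1 h2 hcq hn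
  rw [G.dist_comm] at d2
  have d3 : G.dist e c = 1 := SimpleGraph.dist_eq_one_iff_adj.2 h4
  have d4 : G.dist q s = 1 := SimpleGraph.dist_eq_one_iff_adj.2 h2.symm
  have d5 : G.dist e q = 1 := SimpleGraph.dist_eq_one_iff_adj.2 h3.symm
  have := dist_add_le ha (u := e) (x := q) h1 (by omega) (by omega)
  omega

end Basic

section Local

variable {u v : V} {k rv : ℕ}

/-- Neighbours of `w` towards `u` do not move away from `v`. -/
lemma dist_lower_le (hc : G.Connected) (ha : alphaMetric G 1)
    {H c s w b q : V} (hHc : G.Adj H c) (hcs : G.Adj c s) (hsw : G.Adj s w) (hwb : G.Adj w b)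
    (hHb : G.dist b H = 4)
    (huH : G.dist u H ≤ k + 1) (hvH : G.dist v H ≤ rv + 1)
    (huc : G.dist u c = k + 1) (hvc : G.dist v c = rv)
    (hvb : G.dist v b = rv + 1) (huw : G.dist u w = k + 1) (hvw : G.dist v w = rv + 1)
    (hwq : G.Adj w q) (huq : G.dist u q = k) : G.dist v q ≤ rv + 1 := by
  by_contra hv
  have bw : G.dist b w = 1 := SimpleGraph.dist_eq_one_iff_adj.2 hwb.symm
  have A1 := dist_adj_bounds hc hHc b
  have A2 := dist_adj_bounds hc hcs b
  have A3 := dist_adj_bounds hc hsw b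
  have v1 := dist_adj_bounds hc hwq v
  -- distances to `c`
  have cs : G.dist c s = 1 := SimpleGraph.dist_eq_one_iff_adj.2 hcs
  have C1 := dist_adj_bounds hc hsw c
  have C2 := dist_adj_bounds hc hwq c
  have cw : G.dist c w = 2 := by
    have h := dist_adj_bounds hc hwb c
    rw [G.dist_comm (u := c) (v := b)] at h
    omega
  have cq : G.dist c q = 2 := by
    have h0 : G.dist c q ≤ 2 := by
      by_contra h3
      have := dist_add_le ha (u := u) (x := c) hwq.symm (by omega) (by omega)
      rw [huq] at this
      omega
    have h1 : G.dist c q ≠ 0 := by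
      rw [Ne, hc.dist_eq_zero_iff]; rintro rfl; omega
    have h2 : G.dist c q ≠ 1 := by
      intro h
      have := dist_adj_bounds hc (SimpleGraph.dist_eq_one_iff_adj.1 h) v
      omega
    omega
  obtain ⟨n, hcn, hnq⟩ := exists_mid hc cq
  have nv1 := dist_adj_bounds hc hcn v
  have nv2 := dist_adj_bounds hc hnq v
  have nu1 := dist_adj_bounds hc hcn u
  have nu2 := dist_adj_bounds hc hnq u
  have bn := dist_adj_bounds hc hcn b
  -- distances to `H`
  have Hc : G.dist H c = 1 := SimpleGraph.dist_eq_one_iff_adj.2 hHc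
  have H1 := dist_adj_bounds hc hcs H
  have H2 := dist_adj_bounds hc hsw H
  have H3 := dist_adj_bounds hc hwb H
  have H4 := dist_adj_bounds hc hwq H
  have H5 := dist_adj_bounds hc hcn H
  have H6 := dist_adj_bounds hc hnq H
  rw [G.dist_comm (u := H) (v := b)] at H3
  have Hq : G.dist H q = 3 := by
    have h0 : G.dist H q ≠ 2 := by
      intro h
      have := dist_add_le ha (u := v) (x := H) hwq (by omega) (by omega)
      omega
    omega
  have un : G.dist u n = k := by
    by_contra hne
    have h3 : G.dist u n = k + 1 := by
      have : G.dist u n ≤ k + 1 := by omega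
      omega
    have := dist_add_le ha (u := u) (x := H) hnq.symm (by omega) (by omega)
    omega
  have hnw : ¬ G.Adj n w := by
    intro h
    have h1 := dist_adj_bounds hc h b
    have := dist_add_le ha (u := v) (x := b) hcn (by omega) (by omega)
    omega
  have hne : n ≠ w := by rintro rfl; omega
  have nw := dist_eq_two hc hnq hwq.symm hne hnw
  rw [G.dist_comm] at nw
  have wq : G.dist w q = 1 := SimpleGraph.dist_eq_one_iff_adj.2 hwq
  have := dist_add_le ha (u := v) (x := w) hnq (by omega) (by omega)
  omega

lemma false_of_long_pair (hc : G.Connected) (ha : alphaMetric G 1)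
    (huv : G.dist u v = k + 1 + rv) {A H c b w y : V}
    (hAH : G.Adj A H) (hHc : G.Adj H c) (hbA : G.dist b A = 5) (hbc : G.dist b c = 3)
    (huA : G.dist u A ≤ k + 2) (hvA : G.dist v A ≤ rv + 1)
    (huH : G.dist u H ≤ k + 1) (hvH : G.dist v H ≤ rv + 1)
    (huc : G.dist u c = k + 1) (hvc : G.dist v c = rv)
    (hub : G.dist u b = k + 2) (hvb : G.dist v b = rv + 1)
    (hwb : G.Adj w b) (hyb : G.Adj y b) (hwy : G.Adj w y)
    (huw : G.dist u w = k + 1) (hvw : G.dist v w = rv + 1)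
    (huy : G.dist u y = k + 2) (hvy : G.dist v y = rv)
    (hAw : G.dist A w = 4) (hAy : G.dist A y = 4)
    (hslice : ∀ z, G.dist u z = k + 1 → G.dist v z = rv → G.dist A z ≤ 3) : False := by
  obtain ⟨s, hcs, hbs⟩ := exists_adj_dist_succ hc (t := b) (x := c) (by omega)
  have sep := dist_le_anchors hc u v
  have hAb : G.dist A b = 5 := by rw [G.dist_comm]; exact hbA
  -- `s` lies in the slice of `c`
  have us := dist_adj_bounds hc hcs u
  have vs := dist_adj_bounds hc hcs v
  have hs := sep s
  have hus : G.dist u s ≤ k + 1 := by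
    by_contra h
    have := dist_add_le ha (u := u) (x := b) hcs (by omega) (by omega)
    omega
  have hvs : G.dist v s ≤ rv := by
    by_contra h
    have := dist_add_le ha (u := v) (x := b) hcs (by omega) (by omega)
    omega
  have As : G.dist A s = 3 := by
    have h := hslice s (by omega) (by omega)
    have := dist_le_anchors hc A b s
    omega
  -- `s` is adjacent to `w`
  obtain ⟨m, hsm, hmb⟩ : ∃ m, G.Adj s m ∧ G.Adj m b := by
    refine exists_mid hc ?_
    rw [G.dist_comm]; omega
  have Am := dist_adj_bounds hc hmb A
  have Am' := dist_adj_bounds hc hsm A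
  have hmw : m ≠ w → G.Adj m w := adj_of_common_far hc ha (b := A) hmb.symm hwb.symm
    (by omega) (by omega)
  have hmy : m ≠ y → G.Adj m y := adj_of_common_far hc ha (b := A) hmb.symm hyb.symm
    (by omega) (by omega)
  have hsw : G.Adj s w := by
    by_contra hn
    have hne : m ≠ w := by rintro rfl; exact hn hsm
    have hsw' : s ≠ w := by rintro rfl; omega
    have hum : G.dist u m ≤ k + 1 :=
      dist_mid_le hc ha hsm (hmw hne) hsw' hn (by omega) (by omega)
    have hny : ¬ G.Adj s y := by
      intro h
      have := dist_mid_le hc ha (u := u) (k := k + 1) h hwy.symm hsw' hn (by omega) (by omega)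
      omega
    have hne' : m ≠ y := by rintro rfl; omega
    have hsy' : s ≠ y := by rintro rfl; omega
    have hvm : G.dist v m ≤ rv :=
      dist_mid_le hc ha hsm (hmy hne') hsy' hny (by omega) (by omega)
    have := hslice m (by have := sep m; omega) (by have := sep m; omega)
    omega
  have bH := dist_adj_bounds hc hAH b
  have bH' := dist_adj_bounds hc hHc b
  have bw : G.dist b w = 1 := SimpleGraph.dist_eq_one_iff_adj.2 hwb.symm
  obtain ⟨q, hwq, huq⟩ := exists_adj_dist_succ hc (t := u) (x := w) (by omega)
  have hvq := dist_lower_le hc ha hHc hcs hsw hwb (by omega) huH hvH huc hvc hvb huw hvw hwq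
    (by omega)
  have hvq' : G.dist v q = rv + 1 := by have := sep q; omega
  have bq := dist_adj_bounds hc hwq b
  -- `q` is adjacent to `s`
  obtain ⟨z, hqz, hvz⟩ := exists_adj_dist_succ hc (t := v) (x := q) (by omega)
  have uz := dist_adj_bounds hc hqz u
  have hz := sep z
  have Az := hslice z (by omega) (by omega)
  have Aq := dist_adj_bounds hc hqz A
  have Aq' := dist_adj_bounds hc hwq A
  have hAq : G.dist A q = 3 := by
    by_contra h
    have := dist_add_le ha (u := u) (x := A) hqz (by omega) (by omega)
    omega
  have hqs : G.Adj q s := adj_of_common_far hc ha (b := A) hwq hsw.symm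
    (by omega) (by omega) (by rintro rfl; omega)
  have hncq : ¬ G.Adj c q := by
    intro h
    have h1 := dist_adj_bounds hc h b
    have := dist_add_le ha (u := v) (x := b) h (by omega) (by omega)
    omega
  have hcq : c ≠ q := by rintro rfl; omega
  -- a common neighbour of `q` and `H`
  have Hc : G.dist H c = 1 := SimpleGraph.dist_eq_one_iff_adj.2 hHc
  have Hs := dist_adj_bounds hc hcs H
  have Hq := dist_adj_bounds hc hqs H
  have HA : G.dist H A = 1 := SimpleGraph.dist_eq_one_iff_adj.2 hAH.symm
  have Hb1 := dist_le_anchors hc H b s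
  have Hb2 := dist_le_anchors hc H b q
  rw [G.dist_comm (u := H) (v := b)] at Hb1 Hb2
  have hHq : G.dist H q = 2 := by
    by_contra h
    have := dist_add_le ha (u := u) (x := H) hqs (by omega) (by omega)
    omega
  obtain ⟨e, hHe, heq⟩ := exists_mid hc hHq
  have be := dist_adj_bounds hc hHe b
  have be' := dist_adj_bounds hc heq b
  have hec : e ≠ c := by rintro rfl; exact hncq heq
  have hes' : e ≠ s := by rintro rfl; omega
  have hce : G.Adj e c := adj_of_common_far hc ha (b := b) hHe hHc
    (by omega) (by omega) hec
  have hes : G.Adj e s := adj_diag_of_four_cycle hc ha hcs hqs.symm heq.symm hce hcq hes' hncq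
  have hnHq : ¬ G.Adj H q := by
    intro h
    have := SimpleGraph.dist_eq_one_iff_adj.2 h
    omega
  have hne : H ≠ q := by rintro rfl; simp at hHq
  have hve : G.dist v e ≤ rv + 1 := dist_mid_le hc ha hHe heq hne hnHq hvH (by omega)
  have ve := dist_adj_bounds hc heq v
  have hve' : G.dist v e = rv + 1 := by
    by_contra h
    have := dist_add_le ha (u := v) (x := b) heq (by omega) (by omega)
    omega
  have Ae := dist_adj_bounds hc hes A
  have AH : G.dist A H = 1 := SimpleGraph.dist_eq_one_iff_adj.2 hAH
  have Ae' := dist_adj_bounds hc hHe A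
  have := dist_add_le ha (u := v) (x := A) hes.symm (by omega) (by omega)
  omega

/-- An edge `wy` at equal distance from `b` leads into the slice towards `b`. -/
lemma exists_slice_of_edge (hc : G.Connected) (ha : alphaMetric G 1)
    (huv : G.dist u v = k + 1 + rv) {w y b : V} {m : ℕ}
    (hwy : G.Adj w y) (huw : G.dist u w = k + 1) (hvw : G.dist v w = rv + 1)
    (hvy : G.dist v y = rv)
    (hub : G.dist u b = k + 2) (hvb : G.dist v b = rv + 1)
    (hbw : G.dist b w = m + 4) (hby : G.dist b y = m + 4) :
    (∃ z, G.Adj w z ∧ G.dist u z = k + 1 ∧ G.dist v z = rv ∧ G.dist b z = m + 3) ∨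
    ∃ h z, G.Adj w h ∧ G.Adj h z ∧ G.dist u h ≤ k + 1 ∧ G.dist v h = rv + 1 ∧
      G.dist u z = k + 1 ∧ G.dist v z = rv ∧ G.dist b z = m + 2 := by
  obtain ⟨h, hwh, hbh⟩ := exists_adj_dist_succ hc (t := b) (x := w) (by omega)
  have sep := dist_le_anchors hc u v
  have uh := dist_adj_bounds hc hwh u
  have vh := dist_adj_bounds hc hwh v
  have huh : G.dist u h ≤ k + 1 := by
    by_contra hh
    have := dist_add_le ha (u := u) (x := b) hwh (by omega) (by omega)
    omega
  have hvh : G.dist v h ≤ rv + 1 := by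
    by_contra hh
    have := dist_add_le ha (u := v) (x := b) hwh (by omega) (by omega)
    omega
  by_cases hyh : G.Adj y h
  · left
    have vh' := dist_adj_bounds hc hyh v
    have : G.dist v h ≤ rv := by
      by_contra hh
      have := dist_add_le ha (u := v) (x := b) hyh (by omega) (by omega)
      omega
    exact ⟨h, hwh, by have := sep h; omega, by have := sep h; omega, by omega⟩
  right
  have hne : y ≠ h := by rintro rfl; omega
  have dyh := dist_eq_two hc hwy.symm hwh hne hyh
  have hyw : G.dist h w = 1 := SimpleGraph.dist_eq_one_iff_adj.2 hwh.symm
  have hvh' : G.dist v h = rv + 1 := by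
    rw [G.dist_comm] at dyh
    have := dist_add_le ha (u := v) (x := h) hwy.symm (by omega) (by omega)
    omega
  obtain ⟨z, hhz, hbz⟩ := exists_adj_dist_succ hc (t := b) (x := h) (by omega)
  have uz := dist_adj_bounds hc hhz u
  have vz := dist_adj_bounds hc hhz v
  have huz : G.dist u z ≤ k + 1 := by
    by_contra hh
    have := dist_add_le ha (u := u) (x := b) hhz (by omega) (by omega)
    omega
  have hvz : G.dist v z ≤ rv + 1 := by
    by_contra hh
    have := dist_add_le ha (u := v) (x := b) hhz (by omega) (by omega)
    omega
  have dyz := dist_adj_bounds hc hhz y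
  have dby := dist_le_anchors hc b y z
  have dwz := dist_adj_bounds hc hwy z
  have dwz' := dist_adj_bounds hc hhz w
  have wh : G.dist w h = 1 := SimpleGraph.dist_eq_one_iff_adj.2 hwh
  rw [G.dist_comm (u := w) (v := z), G.dist_comm (u := w) (v := h)] at dwz'
  rw [G.dist_comm (u := z) (v := y)] at dwz
  have hyz : G.dist y z = 2 := by
    by_contra hh
    have := dist_add_le ha (u := v) (x := z) hwy.symm (by omega)
      (by rw [G.dist_comm (u := z) (v := y)]; omega)
    rw [G.dist_comm (u := z) (v := y)] at this
    omega
  obtain ⟨p, hyp, hpz⟩ := exists_mid hc hyz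
  have bp := dist_adj_bounds hc hyp b
  have bp' := dist_adj_bounds hc hpz b
  have vp := dist_adj_bounds hc hyp v
  have vp' := dist_adj_bounds hc hpz v
  have hvp : G.dist v p ≤ rv := by
    by_contra hh
    have := dist_add_le ha (u := v) (x := b) hyp (by omega) (by omega)
    omega
  have hvz' : G.dist v z ≤ rv := by
    by_contra hh
    have := dist_add_le ha (u := v) (x := b) hpz (by omega) (by omega)
    omega
  have hz := sep z
  exact ⟨h, z, hwh, hhz, huh, hvh', by omega, by omega, by omega⟩

/-- The equidistant edge `wx` and the edge `w'y` near `b` cannot coexist at distance `5`. -/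
lemma false_of_equidistant_edge (hc : G.Connected) (ha : alphaMetric G 1)
    (huv : G.dist u v = k + 1 + rv) {w x b w' y : V}
    (hwx : G.Adj w x) (huw : G.dist u w = k + 1) (hvw : G.dist v w = rv + 1)
    (hvx : G.dist v x = rv) (hbw : G.dist b w = 5) (hbx : G.dist b x = 5)
    (hub : G.dist u b = k + 2) (hvb : G.dist v b = rv + 1)
    (hbw' : G.Adj b w') (hby : G.Adj b y) (hwy : G.Adj w' y)
    (huw' : G.dist u w' = k + 1) (hvw' : G.dist v w' = rv + 1)
    (huy : G.dist u y = k + 2) (hvy : G.dist v y = rv)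
    (hww' : G.dist w w' = 4) (hwy' : G.dist w y = 4)
    (hslice : ∀ t, t = w ∨ t = b →
      ∀ z, G.dist u z = k + 1 → G.dist v z = rv → G.dist t z ≤ 3) : False := by
  rcases exists_slice_of_edge hc ha huv (m := 1) hwx huw hvw hvx hub hvb hbw hbx with
    ⟨z, -, huz, hvz, hbz⟩ | ⟨p, z, hwp, hpz, hup, hvp, huz, hvz, hbz⟩
  · have := hslice b (.inr rfl) z huz hvz
    omega
  · exact false_of_long_pair hc ha huv hwp hpz hbw hbz (by omega) hvw.le hup hvp.le
      huz hvz hub hvb hbw'.symm hby.symm hwy huw' hvw' huy hvy hww' hwy'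
      (hslice w (.inl rfl))

end Local

section Level

/-- The bound holds for `ru = k`, and for `ru = k + 1` when `ra + rb < R`. -/
structure Level (G : SimpleGraph V) (u v : V) (k rv R : ℕ) : Prop where
  conn : G.Connected
  alpha : alphaMetric G 1
  duv : G.dist u v = k + 1 + rv
  lower : ∀ a b ra rb, G.dist u a ≤ k + ra → G.dist v a ≤ rv + 1 + ra →
    G.dist u b ≤ k + rb → G.dist v b ≤ rv + 1 + rb → G.dist a b ≤ ra + rb + 2
  smaller : ∀ a b ra rb, ra + rb < R → G.dist u a ≤ k + 1 + ra → G.dist v a ≤ rv + ra →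
    G.dist u b ≤ k + 1 + rb → G.dist v b ≤ rv + rb → G.dist a b ≤ ra + rb + 2

/-- A pair `a`, `b` that violates the bound at `ru = k + 1`. -/
structure Bad (G : SimpleGraph V) (u v : V) (k rv R : ℕ) (a b : V) (ra rb : ℕ) : Prop where
  sum : ra + rb = R
  ua : G.dist u a ≤ k + 1 + ra
  va : G.dist v a ≤ rv + ra
  ub : G.dist u b ≤ k + 1 + rb
  vb : G.dist v b ≤ rv + rb
  far : R + 3 ≤ G.dist a b

variable {u v a b : V} {k rv R ra rb : ℕ}

lemma Bad.symm (h : Bad G u v k rv R a b ra rb) : Bad G u v k rv R b a rb ra :=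
  ⟨by have := h.sum; omega, h.ub, h.vb, h.ua, h.va, by rw [G.dist_comm]; exact h.far⟩

lemma Bad.no_rise (L : Level G u v k rv R) (h : Bad G u v k rv R a b ra rb) {x : V}
    (hx : G.Adj a x) (hbx : G.dist b x + 1 = G.dist b a) :
    G.dist u x ≤ G.dist u a ∧ G.dist v x ≤ G.dist v a := by
  obtain ⟨h1, h2, h3, h4, h5, h6⟩ := h
  have sep := dist_le_anchors L.conn u v a
  have duv := L.duv
  have hu := dist_adj_bounds L.conn hx u
  have hv := dist_adj_bounds L.conn hx v
  rw [G.dist_comm] at h6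
  constructor
  · by_contra hn
    have := dist_add_le L.alpha (u := u) (x := b) hx (by omega) (by omega)
    omega
  · by_contra hn
    have := dist_add_le L.alpha (u := v) (x := b) hx (by omega) (by omega)
    omega

lemma Bad.tight_of_far (L : Level G u v k rv R) (h : Bad G u v k rv R a b ra rb) {x : V}
    (hx : R + 2 ≤ G.dist b x) : k + 1 + ra ≤ G.dist u x ∨ rv + ra ≤ G.dist v x := by
  by_contra! hn
  obtain ⟨h1, h2, h3, h4, h5, h6⟩ := h
  have sep := dist_le_anchors L.conn u v x
  have duv := L.duv
  have := L.smaller x b (ra - 1) rb (by omega) (by omega) (by omega) h4 h5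
  rw [G.dist_comm] at this
  omega

lemma Bad.tight_u (L : Level G u v k rv R) (h : Bad G u v k rv R a b ra rb) :
    G.dist u a = k + 1 + ra ∨ G.dist u b = k + 1 + rb := by
  by_contra! hn
  obtain ⟨h1, h2, h3, h4, h5, h6⟩ := h
  have := L.lower a b ra rb (by omega) (by omega) (by omega) (by omega)
  omega

lemma Bad.tight_v_of_loose (L : Level G u v k rv R) (h : Bad G u v k rv R a b ra rb)
    (hua : G.dist u a = k + 1 + ra) (hub : G.dist u b < k + 1 + rb) :
    G.dist v a = rv + ra := by
  have ⟨h1, h2, h3, h4, h5, h6⟩ := h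
  obtain ⟨w, haw, huw⟩ := exists_adj_dist_succ L.conn (t := u) (x := a) (by omega)
  have hv := dist_adj_bounds L.conn haw v
  have hb := dist_adj_bounds L.conn haw b
  have hwb := L.lower w b ra rb (by omega) (by omega) (by omega) (by omega)
  rw [G.dist_comm] at hwb h6
  have := (h.no_rise L haw (by omega)).2
  have := h.tight_of_far L (x := w) (by omega)
  omega

/-- Consequences of a bad pair that is tight at `u` on both sides but loose at `v` for `a`. -/
lemma Bad.flat_lower (L : Level G u v k rv R) (h : Bad G u v k rv R a b ra rb)
    (hua : G.dist u a = k + 1 + ra) (hub : G.dist u b = k + 1 + rb)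
    (hva : G.dist v a < rv + ra) {w : V} (haw : G.Adj a w)
    (huw : G.dist u w + 1 = G.dist u a) :
    Bad G u v k rv R w b ra rb ∧ G.dist v w = rv + ra ∧ G.dist v b = rv + rb := by
  have ⟨h1, h2, h3, h4, h5, h6⟩ := h
  have hv := dist_adj_bounds L.conn haw v
  have hb := dist_adj_bounds L.conn haw b
  rw [G.dist_comm] at h6
  have hfar : R + 3 ≤ G.dist b w := by
    by_contra hn
    have := (h.no_rise L haw (by omega)).2
    have := h.tight_of_far L (x := w) (by omega)
    omega
  have hw : Bad G u v k rv R w b ra rb :=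
    ⟨h1, by omega, by omega, h4, h5, by rw [G.dist_comm]; exact hfar⟩
  refine ⟨hw, ?_, hw.symm.tight_v_of_loose L hub (by omega)⟩
  have := h.tight_of_far L (x := w) (by omega)
  omega

lemma Bad.false_of_flat (L : Level G u v k rv R) (h : Bad G u v k rv R a b 1 rb)
    (hua : G.dist u a = k + 1 + 1) (hub : G.dist u b = k + 1 + rb) (hva : G.dist v a = rv)
    {w w' : V} (haw : G.Adj a w) (huw : G.dist u w = k + 1) (hvw : G.dist v w = rv + 1)
    (hvb : G.dist v b = rv + rb) (hab : G.dist a b = R + 3) (hwb : G.dist w b = R + 3)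
    (hbw : G.Adj b w') (huw' : G.dist u w' = k + rb) (hvw' : G.dist v w' = rv + rb)
    (hww4 : G.dist w w' = R + 2) : False := by
  have hc := L.conn
  have ha := L.alpha
  have duv := L.duv
  have h1 := h.sum
  have vu : G.dist v u = k + 1 + rv := by rw [G.dist_comm]; exact duv
  have sw' := dist_le_anchors hc u v w'
  obtain ⟨y, hby, hvy⟩ := exists_adj_dist_succ hc (t := v) (x := b)
    (by omega)
  have uy := dist_adj_bounds hc hby u
  have huy : G.dist u y ≤ k + 1 + rb := by
    by_contra hn
    have := dist_add_le ha (u := u) (x := v) hby (by omega) (by omega)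
    omega
  have dwy := dist_adj_bounds hc hby w
  have day := dist_adj_bounds hc hby a
  have hwy : G.dist w y ≤ R + 2 := by
    by_contra hn
    have hB : Bad G u v k rv R w y 1 rb :=
      ⟨h1, by omega, by omega, huy, by omega, by omega⟩
    have h7 := hB.tight_u L
    have := hB.symm.tight_v_of_loose L (by omega) (by omega)
    omega
  have hay : G.dist a y ≤ R + 2 := by
    by_contra hn
    have hB : Bad G u v k rv R a y 1 rb :=
      ⟨h1, by omega, by omega, huy, by omega, by omega⟩
    have h7 := hB.symm.tight_of_far L (x := y) (by omega)
    have := (hB.flat_lower L hua (by omega) (by omega) haw (by omega)).2.2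
    omega
  have huy' : G.dist u y = k + 1 + rb := by
    have := h.symm.tight_of_far L (x := y) (by omega)
    clear dwy day
    omega
  clear uy
  have hadj : G.Adj w' y := adj_of_common_far hc ha (b := w) hbw hby (by omega) (by omega)
    (by rintro rfl; omega)
  have hrb : rb = 1 := by
    have := dist_add_le ha (u := v) (x := u) hadj.symm (by omega) (by omega)
    omega
  have hbw5 : G.dist b w = 5 := by rw [G.dist_comm]; omega
  have hba5 : G.dist b a = 5 := by rw [G.dist_comm]; omega
  have hwy4 : G.dist w y = 4 := by omega
  obtain rfl : R = 2 := by omega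
  subst hrb
  refine false_of_equidistant_edge hc ha duv haw.symm huw hvw hva
    hbw5 hba5 hub hvb hbw hby hadj (by omega) hvw' huy'
    (by omega) hww4 hwy4 ?_
  have hub' := hub.le
  have hvb' := hvb.le
  have huw1 : G.dist u w ≤ k + 1 + 1 := by omega
  clear * - L huw1 hvw hub' hvb'
  rintro t (rfl | rfl) z hz1 hz2
  · exact L.smaller t z 1 0 (by omega) huw1 hvw.le hz1.le hz2.le
  · exact L.smaller t z 1 0 (by omega) hub' hvb' hz1.le hz2.le

lemma Bad.tight_v_of_tight (L : Level G u v k rv R) (h : Bad G u v k rv R a b ra rb)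
    (hua : G.dist u a = k + 1 + ra) (hub : G.dist u b = k + 1 + rb) :
    G.dist v a = rv + ra := by
  have ⟨h1, h2, h3, h4, h5, h6⟩ := h
  by_contra hne
  have hva : G.dist v a < rv + ra := by omega
  clear hne
  have hc := L.conn
  have ha := L.alpha
  have duv := L.duv
  have sep := dist_le_anchors hc u v
  have vu : G.dist v u = k + 1 + rv := by rw [G.dist_comm]; exact duv
  obtain ⟨w, haw, huw⟩ := exists_adj_dist_succ hc (t := u) (x := a) (by omega)
  obtain ⟨hw, hvw, hvb⟩ := h.flat_lower L hua hub hva haw huw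
  have vw := dist_adj_bounds hc haw v
  have hra : ra = 1 := by
    have := dist_add_le ha (u := v) (x := u) haw (by omega) (by omega)
    have := sep a
    omega
  subst hra
  have hva0 : G.dist v a = rv := by omega
  clear vw hva
  obtain ⟨w', hbw, huw'⟩ := exists_adj_dist_succ hc (t := u) (x := b) (by omega)
  have vw' := dist_adj_bounds hc hbw v
  have hww := L.lower w w' 1 rb (by omega) (by omega) (by omega) (by omega)
  have dw := dist_adj_bounds hc hbw w
  have hwfar := hw.far
  have da := dist_adj_bounds hc hbw a
  have dw' := dist_adj_bounds hc haw w'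
  rw [G.dist_comm (v := a), G.dist_comm (v := w)] at dw'
  have db := dist_adj_bounds hc haw b
  rw [G.dist_comm (v := a), G.dist_comm (v := w)] at db
  have haw' : G.dist a w' = R + 2 := by
    by_contra hn
    have := dist_add_le ha (u := v) (x := w') haw (by omega)
      (by rw [G.dist_comm (v := a), G.dist_comm (v := w)]; omega)
    rw [G.dist_comm (u := w')] at this
    omega
  have hab : G.dist a b = R + 3 := by omega
  have hwb : G.dist w b = R + 3 := by omega
  have hww4 : G.dist w w' = R + 2 := by omega
  clear hww dw hwfar da dw' db
  have := (h.symm.no_rise L hbw (by omega)).2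
  have hvw' : G.dist v w' = rv + rb := by
    have := h.symm.tight_of_far L (x := w') (by omega)
    omega
  exact h.false_of_flat L (by omega) hub hva0 haw (by omega) hvw hvb hab hwb hbw (by omega) hvw'
    hww4

lemma Bad.tight_u_right (L : Level G u v k rv R) (h : Bad G u v k rv R a b ra rb)
    (hua : G.dist u a = k + 1 + ra) : G.dist u b = k + 1 + rb := by
  have ⟨h1, h2, h3, h4, h5, h6⟩ := h
  by_contra hub
  have hc := L.conn
  have duv := L.duv
  have sep := dist_le_anchors hc u v b
  have hvb : G.dist v b = rv + rb := by
    have := h.symm.tight_of_far L (x := b) (by omega)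
    omega
  obtain ⟨y, hby, hvy⟩ := exists_adj_dist_succ hc (t := v) (x := b) (by omega)
  have uy := dist_adj_bounds hc hby u
  have ay := dist_adj_bounds hc hby a
  by_cases hfar : R + 3 ≤ G.dist a y
  · have hB : Bad G u v k rv R a y ra rb := ⟨h1, h2, h3, by omega, by omega, hfar⟩
    have := hB.symm.tight_of_far L (x := y) (by omega)
    have := hB.symm.tight_v_of_tight L (by omega) hua
    omega
  · have := (h.symm.no_rise L hby (by omega)).1
    have := h.symm.tight_of_far L (x := y) (by omega)
    omega

lemma Bad.tight (L : Level G u v k rv R) (h : Bad G u v k rv R a b ra rb) :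
    (G.dist u a = k + 1 + ra ∧ G.dist v a = rv + ra) ∧
      G.dist u b = k + 1 + rb ∧ G.dist v b = rv + rb := by
  have hu : G.dist u a = k + 1 + ra ∧ G.dist u b = k + 1 + rb := by
    rcases h.tight_u L with hua | hub
    · exact ⟨hua, h.tight_u_right L hua⟩
    · exact ⟨h.symm.tight_u_right L hub, hub⟩
  exact ⟨⟨hu.1, h.tight_v_of_tight L hu.1 hu.2⟩, hu.2, h.symm.tight_v_of_tight L hu.2 hu.1⟩

lemma Bad.exists_corner (L : Level G u v k rv R) (h : Bad G u v k rv R a b ra rb)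
    (hra : 0 < ra) :
    ra = 1 ∧ G.dist a b = R + 3 ∧ ∃ w y, G.Adj a w ∧ G.Adj a y ∧ G.Adj w y ∧
      G.dist u w = k + 1 ∧ G.dist v w = rv + 1 ∧ G.dist u y = k + 2 ∧ G.dist v y = rv ∧
      G.dist b w = R + 2 ∧ G.dist b y = R + 2 := by
  have ⟨h1, h2, h3, h4, h5, h6⟩ := h
  obtain ⟨⟨hua, hva⟩, -, -⟩ := h.tight L
  have hc := L.conn
  have ha := L.alpha
  have duv := L.duv
  have vu : G.dist v u = k + 1 + rv := by rw [G.dist_comm]; exact duv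
  have hba := G.dist_comm (u := a) (v := b)
  obtain ⟨w, haw, huw⟩ := exists_adj_dist_succ hc (t := u) (x := a) (by omega)
  obtain ⟨y, hay, hvy⟩ := exists_adj_dist_succ hc (t := v) (x := a) (by omega)
  have vw := dist_adj_bounds hc haw v
  have uy := dist_adj_bounds hc hay u
  have bw := dist_adj_bounds hc haw b
  have bY := dist_adj_bounds hc hay b
  have hvw : G.dist v w ≤ rv + ra := by
    by_contra hn
    have := dist_add_le ha (u := v) (x := u) haw (by omega) (by omega)
    omega
  have huy : G.dist u y ≤ k + 1 + ra := by
    by_contra hn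
    have := dist_add_le ha (u := u) (x := v) hay (by omega) (by omega)
    omega
  have hbw : G.dist b w ≤ R + 2 := by
    by_contra hn
    have hB : Bad G u v k rv R w b ra rb :=
      ⟨h1, by omega, hvw, h4, h5, by rw [G.dist_comm]; omega⟩
    have := (hB.tight L).1.1
    omega
  have hby : G.dist b y ≤ R + 2 := by
    by_contra hn
    have hB : Bad G u v k rv R y b ra rb :=
      ⟨h1, huy, by omega, h4, h5, by rw [G.dist_comm]; omega⟩
    have := (hB.tight L).1.2
    omega
  have hw := h.tight_of_far L (x := w) (by omega)
  have hy := h.tight_of_far L (x := y) (by omega)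
  have hwy : G.Adj w y := adj_of_common_far hc ha (b := b) haw hay (by omega) (by omega)
    (by rintro rfl; omega)
  have := dist_add_le ha (u := v) (x := u) hwy.symm (by omega) (by omega)
  exact ⟨by omega, by omega, w, y, haw, hay, hwy, by omega, by omega, by omega, by omega,
    by omega, by omega⟩

lemma not_bad_zero_zero (L : Level G u v k rv R) : ¬ Bad G u v k rv R a b 0 0 := by
  intro h
  have ⟨h1, h2, h3, h4, h5, h6⟩ := h
  obtain ⟨⟨hua, hva⟩, hub, hvb⟩ := h.tight L
  have hc := L.conn
  have ha := L.alpha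
  have duv := L.duv
  have sep := dist_le_anchors hc u v
  have hba := G.dist_comm (u := a) (v := b)
  obtain ⟨w, haw, huw⟩ := exists_adj_dist_succ hc (t := u) (x := a) (by omega)
  obtain ⟨x, hbx, hux⟩ := exists_adj_dist_succ hc (t := u) (x := b) (by omega)
  have vw := dist_adj_bounds hc haw v
  have vx := dist_adj_bounds hc hbx v
  have hwx := L.lower w x 0 0 (by omega) (by omega) (by omega) (by omega)
  have bw := dist_adj_bounds hc haw b
  have ax := dist_adj_bounds hc hbx a
  have xw := dist_adj_bounds hc haw x
  have wx := G.dist_comm (u := w) (v := x)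
  have xa := G.dist_comm (u := a) (v := x)
  have hw := sep w
  have hx := sep x
  have hax : G.dist a b ≤ G.dist a x := by
    by_contra hn
    have := (h.symm.no_rise L hbx (by omega)).2
    omega
  have := dist_add_le ha (u := v) (x := x) haw (by omega) (by omega)
  omega

lemma not_bad_zero (L : Level G u v k rv R) : ¬ Bad G u v k rv R a b 0 rb := by
  intro h
  rcases Nat.eq_zero_or_pos rb with rfl | hrb
  · exact not_bad_zero_zero L h
  obtain ⟨hrb1, hba, w, y, hbw, hby, hwy, huw, hvw, huy, hvy, haw, hay⟩ :=
    h.symm.exists_corner L hrb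
  subst hrb1
  obtain rfl : R = 1 := by have := h.sum; omega
  obtain ⟨⟨hua, hva⟩, hub, hvb⟩ := h.tight L
  have hc := L.conn
  have ha := L.alpha
  have duv := L.duv
  have sep := dist_le_anchors hc u v
  have slice : ∀ {x z}, G.Adj x z → G.dist u x = k + 1 → G.dist v x = rv →
      G.dist b z + 1 = G.dist b x → 3 ≤ G.dist b x →
      G.dist u z = k + 1 ∧ G.dist v z = rv := by
    intro x z hxz hux hvx hbz hbx
    have uz := dist_adj_bounds hc hxz u
    have vz := dist_adj_bounds hc hxz v
    have hz := sep z
    have h7 : G.dist u z ≤ k + 1 := by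
      by_contra hn
      have := dist_add_le ha (u := u) (x := b) hxz (by omega) (by omega)
      omega
    have h8 : G.dist v z ≤ rv := by
      by_contra hn
      have := dist_add_le ha (u := v) (x := b) hxz (by omega) (by omega)
      omega
    omega
  obtain ⟨c, hac, hbc⟩ := exists_adj_dist_succ hc (t := b) (x := a) (by omega)
  obtain ⟨huc, hvc⟩ := slice hac (by omega) (by omega) hbc (by omega)
  obtain ⟨s, hcs, hbs⟩ := exists_adj_dist_succ hc (t := b) (x := c) (by omega)
  obtain ⟨hus, hvs⟩ := slice hcs huc hvc hbs (by omega)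
  -- `s` is adjacent to `w`
  have hab := G.dist_comm (u := a) (v := b)
  obtain ⟨m, hsm, hmb⟩ : ∃ m, G.Adj s m ∧ G.Adj m b :=
    exists_mid hc (by rw [G.dist_comm]; omega)
  have as1 : G.dist a c = 1 := SimpleGraph.dist_eq_one_iff_adj.2 hac
  have as2 := dist_adj_bounds hc hcs a
  have as3 := dist_adj_bounds hc hsm a
  have as4 := dist_adj_bounds hc hmb a
  have hsw : G.Adj s w := by
    by_contra hn
    have hne : m ≠ w := by rintro rfl; exact hn hsm
    have hsw' : s ≠ w := by rintro rfl; omega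
    have hmw : G.Adj m w := adj_of_common_far hc ha (b := a) hmb.symm hbw
      (by omega) (by omega) hne
    have hum : G.dist u m ≤ k + 1 :=
      dist_mid_le hc ha hsm hmw hsw' hn (by omega) (by omega)
    have hny : ¬ G.Adj s y := by
      intro h
      have := dist_mid_le hc ha (u := u) (k := k + 1) h hwy.symm hsw' hn (by omega) (by omega)
      omega
    have hne' : m ≠ y := by rintro rfl; omega
    have hsy' : s ≠ y := by rintro rfl; omega
    have hmy : G.Adj m y := adj_of_common_far hc ha (b := a) hmb.symm hby
      (by omega) (by omega) hne'
    have hvm : G.dist v m ≤ rv :=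
      dist_mid_le hc ha hsm hmy hsy' hny (by omega) (by omega)
    have := L.smaller a m 0 0 (by omega) (by omega) (by omega) (by omega) (by omega)
    omega
  clear as1 as2 as3 as4
  obtain ⟨q, hwq, huq⟩ := exists_adj_dist_succ hc (t := u) (x := w) (by omega)
  have hvq := dist_lower_le hc ha hac hcs hsw hbw.symm (by omega) (by omega) (by omega) huc hvc
    (by omega) huw hvw hwq (by omega)
  have hq := sep q
  have aq := dist_adj_bounds hc hwq a
  have bq := dist_adj_bounds hc hwq b
  have bw : G.dist b w = 1 := SimpleGraph.dist_eq_one_iff_adj.2 hbw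
  have hvq' : G.dist v q = rv + 1 := by omega
  have hbq : G.dist b q ≤ 2 := by omega
  clear hvq hq bq bw
  obtain ⟨x, hax, hux⟩ := exists_adj_dist_succ hc (t := u) (x := a) (by omega)
  have vx := dist_adj_bounds hc hax v
  have hx := sep x
  have hxq := L.lower x q 0 0 (by omega) (by omega) (by omega) (by omega)
  have qx := dist_adj_bounds hc hax q
  have cqx := G.dist_comm (u := q) (v := x)
  have cqa := G.dist_comm (u := q) (v := a)
  have haq : G.dist a q = 2 := by
    by_contra hn
    have := dist_add_le ha (u := v) (x := q) hax (by omega) (by omega)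
    omega
  clear aq vx hx hxq qx cqx cqa
  obtain ⟨n, han, hnq⟩ := exists_mid hc haq
  have bn := dist_adj_bounds hc han b
  have bn' := dist_adj_bounds hc hnq b
  obtain ⟨hun, hvn⟩ := slice han (by omega) (by omega) (by omega) (by omega)
  have := dist_add_le ha (u := v) (x := b) hnq (by omega) (by omega)
  omega

lemma not_bad (L : Level G u v k rv R) : ¬ Bad G u v k rv R a b ra rb := by
  intro h
  rcases Nat.eq_zero_or_pos ra with rfl | hra
  · exact not_bad_zero L h
  rcases Nat.eq_zero_or_pos rb with rfl | hrb
  · exact not_bad_zero L h.symm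
  obtain ⟨hra1, hab, w, y, haw, -, hwy, huw, hvw, huy, hvy, hbw, hby⟩ := h.exists_corner L hra
  obtain ⟨hrb1, -, w', y', hbw', hby', hwy', huw', hvw', huy', hvy', haw', hay'⟩ :=
    h.symm.exists_corner L hrb
  have ⟨h1, h2, h3, h4, h5, h6⟩ := h
  obtain ⟨⟨hua, hva⟩, hub, hvb⟩ := h.tight L
  have hc := L.conn
  have ha := L.alpha
  have hba : G.dist b a = 5 := by rw [G.dist_comm]; omega
  rcases exists_slice_of_edge hc ha L.duv (b := b) (m := 0) hwy huw hvw hvy (by omega) (by omega)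
    (by omega) (by omega) with
    ⟨z, hwz, huz, hvz, hbz⟩ | ⟨p, z, hwp, hpz, hup, hvp, huz, hvz, hbz⟩
  · exact false_of_long_pair hc ha L.duv haw hwz hba hbz (by omega) (by omega) (by omega)
      (by omega) huz hvz (by omega) (by omega) hbw'.symm hby'.symm hwy' huw' hvw' huy' hvy'
      (by omega) (by omega) fun z hz1 hz2 =>
        L.smaller a z 1 0 (by omega) (by omega) (by omega) (by omega) (by omega)
  · have dw : G.dist a w = 1 := SimpleGraph.dist_eq_one_iff_adj.2 haw
    have dp := dist_adj_bounds hc hwp a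
    have dz := dist_adj_bounds hc hpz a
    have dab := dist_le_anchors hc a b z
    have := dist_add_le ha (u := v) (x := a) hpz.symm (by omega) (by omega)
    omega

end Level

end AlphaMetric

theorem stmt11 {V : Type*} [Fintype V] (G : SimpleGraph V) (hconn : G.Connected)
    (halpha : alphaMetric G 1) (u v a b : V) (ru rv ra rb : ℕ)
    (hd : G.dist u v = ru + rv)
    (hua : G.dist u a ≤ ru + ra) (hva : G.dist v a ≤ rv + ra)
    (hub : G.dist u b ≤ ru + rb) (hvb : G.dist v b ≤ rv + rb) :
    G.dist a b ≤ ra + rb + 2 := by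
  induction ru generalizing rv a b ra rb with
  | zero =>
    have h : G.dist a b ≤ G.dist a u + G.dist u b := hconn.dist_triangle
    rw [G.dist_comm (u := a) (v := u)] at h
    omega
  | succ k ih =>
    obtain ⟨R, hR⟩ : ∃ R, ra + rb = R := ⟨_, rfl⟩
    induction R using Nat.strong_induction_on generalizing a b ra rb with
    | _ R ihR =>
      have L : AlphaMetric.Level G u v k rv R :=
        { conn := hconn
          alpha := halpha
          duv := hd
          lower := fun a b ra rb h1 h2 h3 h4 =>
            ih a b (rv + 1) ra rb (by omega) h1 h2 h3 h4
          smaller := fun a b ra rb hlt h1 h2 h3 h4 =>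
            ihR _ hlt a b ra rb h1 h2 h3 h4 rfl }
      by_contra hn
      exact AlphaMetric.not_bad L ⟨hR, hua, hva, hub, hvb, by omega⟩
end

section
/- Every α_1-metric graph is 1-hyperbolic; that is, for every four vertices u,v,w,x of an α_1-metric graph, the difference between the largest and the second largest of the three sums d(u,v)+d(w,x), d(u,w)+d(v,x), d(u,x)+d(v,w) is at most 2. -/
/-- `G` is `δ`-hyperbolic with `c = 2δ`: for every four vertices, the difference
between the largest and the second largest of the three distance sums
`d(u,v)+d(w,x)`, `d(u,w)+d(v,x)`, `d(u,x)+d(v,w)` is at most `c`. Equivalently,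
each of the three sums is at most the maximum of the other two plus `c`. -/
def hyperbolic {V : Type*} (G : SimpleGraph V) (c : ℕ) : Prop :=
  ∀ u v w x : V,
    G.dist u v + G.dist w x ≤ max (G.dist u w + G.dist v x) (G.dist u x + G.dist v w) + c ∧
    G.dist u w + G.dist v x ≤ max (G.dist u v + G.dist w x) (G.dist u x + G.dist v w) + c ∧
    G.dist u x + G.dist v w ≤ max (G.dist u v + G.dist w x) (G.dist u w + G.dist v x) + c

namespace SimpleGraph

section AlphaOne

variable {V : Type*} {G : SimpleGraph V}

theorem Connected.exists_dist_eq_one_of_pos (hconn : G.Connected) {p q : V}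
    (hpq : 0 < G.dist p q) : ∃ p', G.dist p p' = 1 ∧ G.dist p' q + 1 = G.dist p q := by
  obtain ⟨W, hW⟩ := hconn.exists_walk_length_eq_dist p q
  cases W with
  | nil => simp at hpq
  | @cons _ p' _ h W' =>
    have h1 : G.dist p p' = 1 := dist_eq_one_iff_adj.2 h
    have h2 := dist_le W'
    have h3 := hconn.dist_triangle (u := p) (v := p') (w := q)
    rw [Walk.length_cons] at hW
    exact ⟨p', h1, by omega⟩

/-- The `α_1`-metric property: if `y` is closer to `p` and its neighbor `z` is closer to `q`, then
the edge `yz` is almost on a shortest path from `p` to `q`. -/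
theorem dist_add_dist_le_of_alphaMetric (halpha : alphaMetric G 1) {p y z q : V}
    (hyz : G.dist y z = 1) (hp : G.dist p z = G.dist p y + 1)
    (hq : G.dist q y = G.dist q z + 1) : G.dist p y + G.dist z q ≤ G.dist p q := by
  have h := halpha p y z q (by omega)
    (by rw [G.dist_comm (u := z), G.dist_comm (u := y) (v := q)]; omega)
    (dist_eq_one_iff_adj.1 hyz)
  rw [G.dist_comm (u := y), G.dist_comm (u := z) (v := q)] at *
  omega

theorem dist_le_one_of_common_neighbor (hconn : G.Connected) (halpha : alphaMetric G 1)
    {p a b q : V} (ha : G.dist p a = 1) (hb : G.dist p b = 1)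
    (haq : G.dist a q + 1 = G.dist p q) (hbq : G.dist b q + 1 = G.dist p q) :
    G.dist a b ≤ 1 := by
  by_contra! h
  have h1 := hconn.dist_triangle (u := a) (v := p) (w := b)
  have h2 := dist_add_dist_le_of_alphaMetric halpha (p := q) (y := a) (z := p) (q := b)
  grind [SimpleGraph.dist_comm]

theorem dist_le_one_or_of_four_cycle (hconn : G.Connected) (halpha : alphaMetric G 1)
    {a b c e : V} (hab : G.dist a b ≤ 1) (hbc : G.dist b c ≤ 1) (hce : G.dist c e ≤ 1)
    (hea : G.dist e a ≤ 1) : G.dist a c ≤ 1 ∨ G.dist b e ≤ 1 := by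
  by_contra! h
  have h1 := hconn.dist_triangle (u := a) (v := b) (w := c)
  have h2 := hconn.dist_triangle (u := b) (v := c) (w := e)
  have h3 := dist_add_dist_le_of_alphaMetric halpha (p := a) (y := b) (z := c) (q := e)
  grind [SimpleGraph.dist_comm]

/-- The slices of the intervals of an `α_1`-metric graph have diameter at most two. -/
theorem dist_le_two_of_mem_slice (hconn : G.Connected) (halpha : alphaMetric G 1) {u v : V}
    (k : ℕ) (x y : V) (hx : G.dist u x = k) (hy : G.dist u y = k)
    (hxv : k + G.dist x v = G.dist u v) (hyv : k + G.dist y v = G.dist u v) :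
    G.dist x y ≤ 2 := by
  induction k generalizing x y with
  | zero =>
    rw [hconn.dist_eq_zero_iff] at hx hy
    subst hx hy
    simp
  | succ k ih =>
    by_contra! hxy
    obtain ⟨x', hxx', hx'⟩ := hconn.exists_dist_eq_one_of_pos (p := x) (q := u)
      (by rw [G.dist_comm]; omega)
    obtain ⟨y', hyy', hy'⟩ := hconn.exists_dist_eq_one_of_pos (p := y) (q := u)
      (by rw [G.dist_comm]; omega)
    rw [G.dist_comm (u := x'), G.dist_comm (u := x) (v := u)] at hx'
    rw [G.dist_comm (u := y'), G.dist_comm (u := y) (v := u)] at hy'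
    have t1 := hconn.dist_triangle (u := u) (v := x') (w := v)
    have t2 := hconn.dist_triangle (u := u) (v := y') (w := v)
    have t3 := hconn.dist_triangle (u := x') (v := x) (w := v)
    have t4 := hconn.dist_triangle (u := y') (v := y) (w := v)
    have t5 := hconn.dist_triangle (u := x') (v := x) (w := y)
    have t6 := hconn.dist_triangle (u := x) (v := x') (w := y)
    have t7 := hconn.dist_triangle (u := x') (v := y') (w := y)
    have c1 := G.dist_comm (u := x) (v := x')
    have c2 := G.dist_comm (u := y) (v := y')
    have hi := ih x' y' (by omega) (by omega) (by omega) (by omega)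
    have a1 := dist_add_dist_le_of_alphaMetric halpha (p := u) (y := x') (z := x) (q := y)
    have a2 := dist_add_dist_le_of_alphaMetric halpha (p := v) (y := x) (z := x') (q := y)
    have a3 := dist_add_dist_le_of_alphaMetric halpha (p := x') (y := y') (z := y) (q := v)
    rw [G.dist_comm (u := y) (v := x), G.dist_comm (u := y) (v := x')] at a1 a2
    rw [G.dist_comm (u := v) (v := x), G.dist_comm (u := v) (v := x'),
      G.dist_comm (u := v) (v := y)] at a2
    rw [G.dist_comm (u := v) (v := y), G.dist_comm (u := v) (v := y')] at a3
    omega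

/-- The distance sum `d(u,v) + d(w,x)` exceeds the other two by at least three. -/
def FourPointExcess (G : SimpleGraph V) (u v w x : V) : Prop :=
  G.dist u w + G.dist v x + 3 ≤ G.dist u v + G.dist w x ∧
    G.dist u x + G.dist v w + 3 ≤ G.dist u v + G.dist w x

/-- The sum of the six distances between four vertices. -/
noncomputable def fourPointSum (G : SimpleGraph V) (u v w x : V) : ℕ :=
  G.dist u v + G.dist w x + G.dist u w + G.dist v x + G.dist u x + G.dist v w

/-- Four vertices violating `1`-hyperbolicity with the least possible sum of distances. -/
structure MinimalExcess (G : SimpleGraph V) (u v w x : V) : Prop where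
  excess : G.FourPointExcess u v w x
  minimal : ∀ u' v' w' x', G.fourPointSum u' v' w' x' < G.fourPointSum u v w x →
    ¬ G.FourPointExcess u' v' w' x'

variable {u v w x : V}

theorem MinimalExcess.swap_left (h : G.MinimalExcess u v w x) : G.MinimalExcess v u w x := by
  have hs : G.fourPointSum v u w x = G.fourPointSum u v w x := by
    simp only [fourPointSum, G.dist_comm (u := v) (v := u)]; omega
  refine ⟨?_, hs ▸ h.minimal⟩
  have := h.excess
  simp only [FourPointExcess, G.dist_comm (u := v) (v := u)] at *
  omega

theorem MinimalExcess.swap_pairs (h : G.MinimalExcess u v w x) : G.MinimalExcess w x u v := by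
  have hs : G.fourPointSum w x u v = G.fourPointSum u v w x := by
    simp only [fourPointSum, G.dist_comm (u := w) (v := u), G.dist_comm (u := w) (v := v),
      G.dist_comm (u := x) (v := u), G.dist_comm (u := x) (v := v)]
    omega
  refine ⟨?_, hs ▸ h.minimal⟩
  have := h.excess
  simp only [FourPointExcess, G.dist_comm (u := w) (v := u), G.dist_comm (u := w) (v := v),
      G.dist_comm (u := x) (v := u), G.dist_comm (u := x) (v := v)] at *
  omega

theorem MinimalExcess.swap_right (h : G.MinimalExcess u v w x) : G.MinimalExcess u v x w :=
  h.swap_pairs.swap_left.swap_pairs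

/-- The distances to `w` do not increase when moving from `u` towards `v`. -/
theorem MinimalExcess.dist_le_of_towards (hconn : G.Connected) (halpha : alphaMetric G 1)
    (h : G.MinimalExcess u v w x) {u' : V} (hu : G.dist u u' = 1)
    (hv : G.dist u' v + 1 = G.dist u v) : G.dist u' w ≤ G.dist u w := by
  have hx := h.excess
  simp only [FourPointExcess] at hx
  have t1 := hconn.dist_triangle (u := u') (v := u) (w := w)
  have t2 := hconn.dist_triangle (u := w) (v := u) (w := x)
  have a1 := dist_add_dist_le_of_alphaMetric halpha (p := w) (y := u) (z := u') (q := v)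
  grind [SimpleGraph.dist_comm]

theorem MinimalExcess.sum_eq (hconn : G.Connected) (halpha : alphaMetric G 1)
    (h : G.MinimalExcess u v w x) :
    G.dist u v + G.dist w x =
      max (G.dist u w + G.dist v x) (G.dist u x + G.dist v w) + 3 := by
  have hx := h.excess
  simp only [FourPointExcess] at hx
  have t1 := hconn.dist_triangle (u := w) (v := u) (w := x)
  have t2 := hconn.dist_triangle (u := w) (v := v) (w := x)
  have c1 := G.dist_comm (u := w) (v := u)
  have c2 := G.dist_comm (u := w) (v := v)
  obtain ⟨u', hu, hv⟩ := hconn.exists_dist_eq_one_of_pos (p := u) (q := v) (by omega)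
  have h1 := h.dist_le_of_towards hconn halpha hu hv
  have h2 := h.swap_right.dist_le_of_towards hconn halpha hu hv
  have h3 := h.minimal u' v w x
  simp only [FourPointExcess, fourPointSum] at h3
  omega

theorem MinimalExcess.towards (hconn : G.Connected) (halpha : alphaMetric G 1)
    (h : G.MinimalExcess u v w x) {u' : V} (hu : G.dist u u' = 1)
    (hw : G.dist u' w + 1 = G.dist u w) :
    G.dist u w + G.dist u x ≤ G.dist w x + 1 ∨
      (G.dist u w + G.dist v x ≤ G.dist u x + G.dist v w ∧
        G.dist u' v + 1 = G.dist u v ∧ G.dist u' x = G.dist u x) := by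
  have hx := h.excess
  simp only [FourPointExcess] at hx
  have h2 := h.swap_right.dist_le_of_towards hconn halpha hu
  have h3 := h.minimal u' v w x
  simp only [FourPointExcess, fourPointSum] at h3
  have t1 := hconn.dist_triangle (u := u') (v := u) (w := v)
  have t2 := hconn.dist_triangle (u := u) (v := u') (w := v)
  have t3 := hconn.dist_triangle (u := u') (v := u) (w := x)
  have t4 := hconn.dist_triangle (u := u) (v := u') (w := x)
  have t5 := hconn.dist_triangle (u := w) (v := u) (w := x)
  have a1 := dist_add_dist_le_of_alphaMetric halpha (p := v) (y := u) (z := u') (q := w)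
  have a2 := dist_add_dist_le_of_alphaMetric halpha (p := x) (y := u) (z := u') (q := w)
  have c1 := G.dist_comm (u := u) (v := u')
  have c2 := G.dist_comm (u := w) (v := u)
  have c3 := G.dist_comm (u := w) (v := u')
  have c4 := G.dist_comm (u := v) (v := u)
  have c5 := G.dist_comm (u := v) (v := u')
  have c6 := G.dist_comm (u := x) (v := u)
  have c7 := G.dist_comm (u := x) (v := u')
  have c8 := G.dist_comm (u := x) (v := w)
  omega

/-- In a minimal violation every vertex is almost between its two other-side vertices, up to an
error of two which requires the two smaller sums to be equal. -/
theorem MinimalExcess.almost_between (hconn : G.Connected) (halpha : alphaMetric G 1)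
    (h : G.MinimalExcess u v w x) :
    G.dist u w + G.dist u x ≤ G.dist w x + 1 ∨
      (G.dist u w + G.dist u x = G.dist w x + 2 ∧
        G.dist u w + G.dist v x = G.dist u x + G.dist v w ∧
        ∃ u₁ u₂, G.dist u u₁ = 1 ∧ G.dist u u₂ = 1 ∧ G.dist u₁ u₂ = 1 ∧
          G.dist u₁ w + 1 = G.dist u w ∧ G.dist u₁ x = G.dist u x ∧
          G.dist u₁ v + 1 = G.dist u v ∧
          G.dist u₂ x + 1 = G.dist u x ∧ G.dist u₂ w = G.dist u w ∧
          G.dist u₂ v + 1 = G.dist u v) := by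
  by_cases hn : G.dist u w + G.dist u x ≤ G.dist w x + 1
  · exact Or.inl hn
  have hx := h.excess
  simp only [FourPointExcess] at hx
  have t1 := hconn.dist_triangle (u := w) (v := u) (w := x)
  have t2 := hconn.dist_triangle (u := u) (v := w) (w := v)
  have t3 := hconn.dist_triangle (u := u) (v := x) (w := v)
  have c1 := G.dist_comm (u := w) (v := u)
  have c2 := G.dist_comm (u := w) (v := v)
  have c3 := G.dist_comm (u := x) (v := v)
  have c4 := G.dist_comm (u := x) (v := w)
  obtain ⟨u₁, hu₁, hw₁⟩ := hconn.exists_dist_eq_one_of_pos (p := u) (q := w) (by omega)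
  obtain ⟨u₂, hu₂, hx₂⟩ := hconn.exists_dist_eq_one_of_pos (p := u) (q := x) (by omega)
  have h1 := h.towards hconn halpha hu₁ hw₁
  have h2 := h.swap_right.towards hconn halpha hu₂ hx₂
  have h3 := dist_le_one_of_common_neighbor hconn halpha hu₁ hu₂ (q := v) (by omega) (by omega)
  have h4 : 0 < G.dist u₁ u₂ := by
    refine hconn.pos_dist_of_ne ?_
    rintro rfl
    omega
  have a1 := dist_add_dist_le_of_alphaMetric halpha (p := x) (y := u₂) (z := u₁) (q := w)
  have c5 := G.dist_comm (u := u₁) (v := u₂)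
  have c6 := G.dist_comm (u := x) (v := u₁)
  have c7 := G.dist_comm (u := x) (v := u₂)
  have c8 := G.dist_comm (u := w) (v := u₁)
  have c9 := G.dist_comm (u := w) (v := u₂)
  refine Or.inr ⟨by omega, by omega, u₁, u₂, hu₁, hu₂, ?_⟩
  omega

theorem dist_add_dist_add_dist_le_of_alphaMetric (hconn : G.Connected) (halpha : alphaMetric G 1)
    {p y z q : V} (hyz : 0 < G.dist y z) (hp : G.dist p y + G.dist y z = G.dist p z)
    (hq : G.dist y z + G.dist z q = G.dist y q) :
    G.dist p y + G.dist y z + G.dist z q ≤ G.dist p q + 1 := by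
  obtain ⟨y', h1, h2⟩ := hconn.exists_dist_eq_one_of_pos hyz
  have t1 := hconn.dist_triangle (u := p) (v := y) (w := y')
  have t2 := hconn.dist_triangle (u := p) (v := y') (w := z)
  have t3 := hconn.dist_triangle (u := y) (v := y') (w := q)
  have t4 := hconn.dist_triangle (u := y') (v := z) (w := q)
  have a1 := dist_add_dist_le_of_alphaMetric halpha (p := p) (y := y) (z := y') (q := q)
  rw [G.dist_comm (u := q) (v := y), G.dist_comm (u := q) (v := y')] at a1
  omega

theorem dist_le_of_mem_interval (hconn : G.Connected) (halpha : alphaMetric G 1) {u v w x : V}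
    (hk : 2 ≤ G.dist u w) (hw : G.dist u w + G.dist w v = G.dist u v) (hux : G.dist u x = 2)
    (hx : 2 + G.dist x v = G.dist u v) : G.dist w x ≤ G.dist u w := by
  obtain ⟨y, h1, h2⟩ := hconn.exists_dist_eq_one_of_pos (p := u) (q := w) (by omega)
  obtain ⟨z, h3, h4⟩ := hconn.exists_dist_eq_one_of_pos (p := y) (q := w) (by omega)
  have t1 := hconn.dist_triangle (u := u) (v := y) (w := z)
  have t2 := hconn.dist_triangle (u := u) (v := z) (w := w)
  have t3 := hconn.dist_triangle (u := u) (v := z) (w := v)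
  have t4 := hconn.dist_triangle (u := z) (v := w) (w := v)
  have t5 := hconn.dist_triangle (u := w) (v := z) (w := x)
  have s := dist_le_two_of_mem_slice hconn halpha (u := u) (v := v) 2 z x
    (by omega) hux (by omega) hx
  have c := G.dist_comm (u := w) (v := z)
  omega

theorem MinimalExcess.sum_le (hconn : G.Connected) (halpha : alphaMetric G 1)
    (h : G.MinimalExcess u v w x) :
    G.dist u w + G.dist v x ≤ G.dist u x + G.dist v w := by
  by_contra! hlt
  have hs := h.sum_eq hconn halpha
  have b1 := h.almost_between hconn halpha
  have b2 := h.swap_left.almost_between hconn halpha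
  have b3 := h.swap_pairs.almost_between hconn halpha
  have b4 := h.swap_pairs.swap_left.almost_between hconn halpha
  have k1 := dist_le_of_mem_interval hconn halpha (u := u) (v := v) (w := w) (x := x)
  have k2 := dist_le_of_mem_interval hconn halpha (u := w) (v := x) (w := u) (x := v)
  have k3 := dist_add_dist_add_dist_le_of_alphaMetric hconn halpha
    (p := w) (y := v) (z := x) (q := u)
  have k4 := dist_add_dist_add_dist_le_of_alphaMetric hconn halpha
    (p := x) (y := u) (z := w) (q := v)
  simp only [G.dist_comm (u := v) (v := u), G.dist_comm (u := w) (v := u),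
    G.dist_comm (u := w) (v := v), G.dist_comm (u := x) (v := u), G.dist_comm (u := x) (v := v),
    G.dist_comm (u := x) (v := w)] at *
  have n1 : G.dist u w + G.dist u x ≤ G.dist w x + 1 := b1.resolve_right fun h => by omega
  have n2 : G.dist v w + G.dist v x ≤ G.dist w x + 1 := b2.resolve_right fun h => by omega
  have n3 : G.dist u w + G.dist v w ≤ G.dist u v + 1 := b3.resolve_right fun h => by omega
  have n4 : G.dist u x + G.dist v x ≤ G.dist u v + 1 := b4.resolve_right fun h => by omega
  clear b1 b2 b3 b4
  have t1 := hconn.dist_triangle (u := w) (v := u) (w := x)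
  have t2 := hconn.dist_triangle (u := w) (v := v) (w := x)
  have t3 := hconn.dist_triangle (u := u) (v := w) (w := v)
  have t4 := hconn.dist_triangle (u := u) (v := x) (w := v)
  simp only [G.dist_comm (u := w) (v := u), G.dist_comm (u := w) (v := v),
    G.dist_comm (u := x) (v := v)] at *
  omega

theorem false_of_midpoint (hconn : G.Connected) (halpha : alphaMetric G 1) {u v x p : V}
    (huv : G.dist u v = 4) (hux : G.dist u x = 2) (hxv : G.dist x v = 2)
    (hpu : G.dist p u = 2) (hpx : G.dist p x = 3) (hpv : G.dist p v = 3) : False := by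
  obtain ⟨y, h1, h2⟩ := hconn.exists_dist_eq_one_of_pos (p := u) (q := x) (by omega)
  have t1 := hconn.dist_triangle (u := u) (v := y) (w := v)
  have t2 := hconn.dist_triangle (u := y) (v := x) (w := v)
  have t3 := hconn.dist_triangle (u := p) (v := u) (w := y)
  have t4 := hconn.dist_triangle (u := p) (v := y) (w := x)
  have a1 := dist_add_dist_le_of_alphaMetric halpha (p := p) (y := u) (z := y) (q := v)
  have a2 := dist_add_dist_le_of_alphaMetric halpha (p := p) (y := y) (z := x) (q := v)
  rw [G.dist_comm (u := v) (v := y), G.dist_comm (u := v)] at a1 a2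
  omega

/-- Let `p`, `p'` and `q`, `q'` be pairs on consecutive distance levels between `w` and `x`. A
midpoint `m` of `p` and a neighbor `y` of `w` is adjacent to `q` and `q'` but not to `p'`. -/
theorem dist_le_one_of_levels (hconn : G.Connected) (halpha : alphaMetric G 1)
    {w x p q p' q' y m : V} (hwx : G.dist w x = 5) (hpm : G.dist p m = 1) (hmy : G.dist m y = 1)
    (hpw : G.dist p w = 3) (hpx : G.dist p x = 2) (hp'x : G.dist p' x = 2)
    (hpq : G.dist p q ≤ 1) (hqw : G.dist q w = 2) (hq'x : G.dist q' x = 3)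
    (hq'y : G.dist q' y = 1) (hyw : G.dist w y = 1) (hyx : G.dist y x = 4)
    (hpp' : 2 ≤ G.dist p p') :
    G.dist m q ≤ 1 ∧ G.dist m q' ≤ 1 ∧ 2 ≤ G.dist m p' := by
  have t1 := hconn.dist_triangle (u := m) (v := y) (w := w)
  have t2 := hconn.dist_triangle (u := m) (v := p) (w := x)
  have t3 := hconn.dist_triangle (u := w) (v := m) (w := x)
  have t4 := hconn.dist_triangle (u := p) (v := q) (w := w)
  have c1 := G.dist_comm (u := w) (v := m)
  have c2 := G.dist_comm (u := w) (v := y)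
  have c3 := G.dist_comm (u := p) (v := m)
  have hmw : G.dist m w = 2 := by omega
  have hmx : G.dist m x = 3 := by omega
  refine ⟨?_, ?_, ?_⟩
  · exact dist_le_one_of_common_neighbor hconn halpha hpm
      (show G.dist p q = 1 by omega) (q := w) (by omega) (by omega)
  · exact dist_le_one_of_common_neighbor hconn halpha (G.dist_comm.trans hmy)
      (G.dist_comm.trans hq'y) (q := x) (by omega) (by omega)
  · by_contra! hmp'
    have t5 := hconn.dist_triangle (u := m) (v := p') (w := x)
    have := dist_le_one_of_common_neighbor hconn halpha (G.dist_comm.trans hpm)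
      (show G.dist m p' = 1 by omega) (q := x) (by omega) (by omega)
    omega

/-- A minimal violation whose sums of distances are `9`, `6`, `6`, together with the neighbors
of `w` and `x` on shortest paths to `u` and to `v`. -/
structure HexagonalExcess (G : SimpleGraph V) (u v w x w₁ w₂ x₁ x₂ : V) : Prop
    extends G.MinimalExcess u v w x where
  uv : G.dist u v = 4
  uw : G.dist u w = 3
  vw : G.dist v w = 3
  ux : G.dist u x = 3
  vx : G.dist v x = 3
  wx : G.dist w x = 5
  ww₁ : G.dist w w₁ = 1
  ww₂ : G.dist w w₂ = 1
  w₁w₂ : G.dist w₁ w₂ = 1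
  uw₁ : G.dist u w₁ = 2
  vw₁ : G.dist v w₁ = 3
  w₁x : G.dist w₁ x = 4
  uw₂ : G.dist u w₂ = 3
  vw₂ : G.dist v w₂ = 2
  w₂x : G.dist w₂ x = 4
  xx₁ : G.dist x x₁ = 1
  xx₂ : G.dist x x₂ = 1
  x₁x₂ : G.dist x₁ x₂ = 1
  ux₁ : G.dist u x₁ = 2
  vx₁ : G.dist v x₁ = 3
  x₁w : G.dist x₁ w = 4
  ux₂ : G.dist u x₂ = 3
  vx₂ : G.dist v x₂ = 2
  x₂w : G.dist x₂ w = 4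

namespace HexagonalExcess

variable {w₁ w₂ x₁ x₂ : V}

theorem swap_left (h : G.HexagonalExcess u v w x w₁ w₂ x₁ x₂) :
    G.HexagonalExcess v u w x w₂ w₁ x₂ x₁ where
  toMinimalExcess := h.toMinimalExcess.swap_left
  uv := G.dist_comm.trans h.uv
  uw := h.vw
  vw := h.uw
  ux := h.vx
  vx := h.ux
  wx := h.wx
  ww₁ := h.ww₂
  ww₂ := h.ww₁
  w₁w₂ := G.dist_comm.trans h.w₁w₂
  uw₁ := h.vw₂
  vw₁ := h.uw₂
  w₁x := h.w₂x
  uw₂ := h.vw₁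
  vw₂ := h.uw₁
  w₂x := h.w₁x
  xx₁ := h.xx₂
  xx₂ := h.xx₁
  x₁x₂ := G.dist_comm.trans h.x₁x₂
  ux₁ := h.vx₂
  vx₁ := h.ux₂
  x₁w := h.x₂w
  ux₂ := h.vx₁
  vx₂ := h.ux₁
  x₂w := h.x₁w

theorem swap_right (h : G.HexagonalExcess u v w x w₁ w₂ x₁ x₂) :
    G.HexagonalExcess u v x w x₁ x₂ w₁ w₂ where
  toMinimalExcess := h.toMinimalExcess.swap_right
  uv := h.uv
  uw := h.ux
  vw := h.vx
  ux := h.uw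
  vx := h.vw
  wx := G.dist_comm.trans h.wx
  ww₁ := h.xx₁
  ww₂ := h.xx₂
  w₁w₂ := h.x₁x₂
  uw₁ := h.ux₁
  vw₁ := h.vx₁
  w₁x := h.x₁w
  uw₂ := h.ux₂
  vw₂ := h.vx₂
  w₂x := h.x₂w
  xx₁ := h.ww₁
  xx₂ := h.ww₂
  x₁x₂ := h.w₁w₂
  ux₁ := h.uw₁
  vx₁ := h.vw₁
  x₁w := h.w₁x
  ux₂ := h.uw₂
  vx₂ := h.vw₂
  x₂w := h.w₂x

theorem dist_w₁_x₁ (hconn : G.Connected) (h : G.HexagonalExcess u v w x w₁ w₂ x₁ x₂) :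
    G.dist w₁ x₁ = 3 := by
  have h3 := h.minimal u v w₁ x₁
  have t1 := hconn.dist_triangle (u := w₁) (v := x₁) (w := x)
  have t2 := hconn.dist_triangle (u := w₁) (v := u) (w := x₁)
  simp only [FourPointExcess, fourPointSum, h.uv, h.uw, h.vw, h.ux, h.vx, h.wx, h.uw₁, h.vx₁,
    h.ux₁, h.vw₁, h.w₁x, G.dist_comm (u := x₁) (v := x), h.xx₁,
    G.dist_comm (u := w₁) (v := u)] at *
  omega

theorem dist_w₁_x₂ (hconn : G.Connected) (halpha : alphaMetric G 1)
    (h : G.HexagonalExcess u v w x w₁ w₂ x₁ x₂) : G.dist w₁ x₂ = 3 := by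
  have h1 := h.dist_w₁_x₁ hconn
  have t1 := hconn.dist_triangle (u := w₁) (v := x₂) (w := x)
  have t2 := hconn.dist_triangle (u := w₁) (v := x₁) (w := x₂)
  have a1 := dist_add_dist_le_of_alphaMetric halpha (p := w₁) (y := x₁) (z := x₂) (q := v)
  simp only [G.dist_comm (u := x₂) (v := x), G.dist_comm (u := x₂) (v := v),
    G.dist_comm (u := w₁) (v := v), h1, h.xx₂, h.x₁x₂, h.w₁x, h.vx₁, h.vx₂, h.vw₁,
    true_imp_iff] at t1 t2 a1 ⊢
  omega

theorem exists_corner (hconn : G.Connected) (halpha : alphaMetric G 1)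
    (h : G.HexagonalExcess u v w x w₁ w₂ x₁ x₂) :
    ∃ p, G.dist u p = 1 ∧ G.dist p x₁ = 1 ∧ G.dist p w = 3 ∧ G.dist p x = 2 ∧ G.dist p v = 3 ∧
      G.dist p w₂ = 2 := by
  have h11 := h.dist_w₁_x₁ hconn
  have h12 := h.dist_w₁_x₂ hconn halpha
  obtain ⟨p, hp, hp1⟩ := hconn.exists_dist_eq_one_of_pos (p := u) (q := x₁) (by simp [h.ux₁])
  have hu2 := h.ux₁
  have hpx1 : G.dist p x₁ = 1 := by omega
  have hpx2 : G.dist p x₂ = 2 := by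
    have t1 := hconn.dist_triangle (u := p) (v := x₁) (w := x₂)
    have t2 := hconn.dist_triangle (u := u) (v := p) (w := x₂)
    have := h.x₁x₂
    have := h.ux₂
    omega
  have hpx : G.dist p x = 2 := by
    have t1 := hconn.dist_triangle (u := p) (v := x₁) (w := x)
    have t2 := hconn.dist_triangle (u := u) (v := p) (w := x)
    have := h.ux
    have := h.xx₁
    rw [G.dist_comm] at this
    omega
  have hw₁p : G.dist w₁ p = 2 := by
    have t1 := hconn.dist_triangle (u := w₁) (v := u) (w := p)
    have t2 := hconn.dist_triangle (u := w₁) (v := p) (w := x₁)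
    have a1 := dist_add_dist_le_of_alphaMetric halpha (p := w₁) (y := u) (z := p) (q := x₂)
    rw [G.dist_comm (u := w₁) (v := u), h.uw₁, G.dist_comm (u := x₂), h.ux₂,
      G.dist_comm (u := x₂), hpx2] at *
    omega
  have hpw : G.dist p w = 3 := by
    have t1 := hconn.dist_triangle (u := p) (v := w₁) (w := w)
    have t2 := hconn.dist_triangle (u := w) (v := p) (w := x)
    rw [G.dist_comm (u := p) (v := w₁), G.dist_comm (u := w₁) (v := w), h.ww₁] at t1
    rw [G.dist_comm (u := w) (v := p), h.wx] at t2
    omega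
  have hpv : G.dist p v = 3 := by
    have t1 := hconn.dist_triangle (u := u) (v := p) (w := v)
    have t2 := hconn.dist_triangle (u := p) (v := x₂) (w := v)
    have h3 := h.minimal p v w x
    simp only [FourPointExcess, fourPointSum, h.uv, h.uw, h.vw, h.ux, h.vx, h.wx,
      G.dist_comm (u := x₂) (v := v), h.vx₂] at *
    omega
  refine ⟨p, hp, hpx1, hpw, hpx, hpv, ?_⟩
  have t1 := hconn.dist_triangle (u := p) (v := w₁) (w := w₂)
  have t2 := hconn.dist_triangle (u := p) (v := w₂) (w := w)
  have a1 := dist_add_dist_le_of_alphaMetric halpha (p := p) (y := w₁) (z := w₂) (q := v)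
  simp only [G.dist_comm (u := w₂) (v := v), G.dist_comm (u := w₂) (v := w), h.w₁w₂, h.vw₁,
    h.vw₂, h.ww₂, G.dist_comm (u := p) (v := w₁), hw₁p, hpw, hpv, true_imp_iff]
    at t1 t2 a1 ⊢
  omega

theorem false (hconn : G.Connected) (halpha : alphaMetric G 1)
    (h : G.HexagonalExcess u v w x w₁ w₂ x₁ x₂) : False := by
  obtain ⟨p₁, up₁, px₁, pw₁, p₁x, p₁v, p₁w₂⟩ := h.exists_corner hconn halpha
  obtain ⟨q₁, uq₁, qw₁, qx₁, q₁w, q₁v, q₁x₂⟩ := h.swap_right.exists_corner hconn halpha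
  obtain ⟨p₂, vp₂, px₂, pw₂, p₂x, p₂u, p₂w₁⟩ := h.swap_left.exists_corner hconn halpha
  obtain ⟨q₂, vq₂, qw₂, qx₂, q₂w, q₂u, q₂x₁⟩ := h.swap_left.swap_right.exists_corner hconn halpha
  have huv := h.uv
  have hvu : G.dist v u = 4 := G.dist_comm.trans h.uv
  have pq₁ := dist_le_one_of_common_neighbor hconn halpha up₁ uq₁ (q := v) (by omega) (by omega)
  have pq₂ := dist_le_one_of_common_neighbor hconn halpha vp₂ vq₂ (q := u) (by omega) (by omega)
  obtain ⟨n₁, qn₁, nx₁⟩ := hconn.exists_dist_eq_one_of_pos (p := q₁) (q := x₂) (by omega)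
  obtain ⟨m₁, pm₁, mw₁⟩ := hconn.exists_dist_eq_one_of_pos (p := p₁) (q := w₂) (by omega)
  obtain ⟨n₂, qn₂, nx₂⟩ := hconn.exists_dist_eq_one_of_pos (p := q₂) (q := x₁) (by omega)
  obtain ⟨m₂, pm₂, mw₂⟩ := hconn.exists_dist_eq_one_of_pos (p := p₂) (q := w₁) (by omega)
  have hpp : 2 ≤ G.dist p₁ p₂ := by
    have := hconn.dist_triangle (u := u) (v := p₁) (w := v)
    have := hconn.dist_triangle (u := p₁) (v := p₂) (w := v)
    rw [G.dist_comm (u := p₂) (v := v)] at this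
    omega
  have hqq : 2 ≤ G.dist q₁ q₂ := by
    have := hconn.dist_triangle (u := q₁) (v := q₂) (w := v)
    rw [G.dist_comm (u := q₂) (v := v)] at this
    omega
  have hqp : 2 ≤ G.dist q₁ p₂ := by
    have := hconn.dist_triangle (u := q₁) (v := p₂) (w := v)
    rw [G.dist_comm (u := p₂) (v := v)] at this
    omega
  have hpq : 2 ≤ G.dist p₁ q₂ := by
    have := hconn.dist_triangle (u := p₁) (v := q₂) (w := v)
    rw [G.dist_comm (u := q₂) (v := v)] at this
    omega
  have hpp' : 2 ≤ G.dist p₂ p₁ := G.dist_comm.symm ▸ hpp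
  have hqq' : 2 ≤ G.dist q₂ q₁ := G.dist_comm.symm ▸ hqq
  have qp₁ : G.dist q₁ p₁ ≤ 1 := G.dist_comm.symm ▸ pq₁
  have qp₂ : G.dist q₂ p₂ ≤ 1 := G.dist_comm.symm ▸ pq₂
  have hxw : G.dist x w = 5 := G.dist_comm.trans h.wx
  obtain ⟨m₁q₁, m₁q₂, m₁p₂⟩ := dist_le_one_of_levels hconn halpha (m := m₁) h.wx pm₁
    (by omega) pw₁ p₁x p₂x pq₁ q₁w qx₂ qw₂ h.ww₂ h.w₂x hpp
  obtain ⟨m₂q₂, m₂q₁, m₂p₁⟩ := dist_le_one_of_levels hconn halpha (m := m₂) h.wx pm₂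
    (by omega) pw₂ p₂x p₁x pq₂ q₂w qx₁ qw₁ h.ww₁ h.w₁x hpp'
  obtain ⟨n₁p₁, n₁p₂, n₁q₂⟩ := dist_le_one_of_levels hconn halpha (m := n₁) hxw qn₁
    (by omega) qx₁ q₁w q₂w qp₁ p₁x pw₂ px₂ h.xx₂ h.x₂w hqq
  obtain ⟨n₂p₂, n₂p₁, n₂q₁⟩ := dist_le_one_of_levels hconn halpha (m := n₂) hxw qn₂
    (by omega) qx₂ q₂w q₁w qp₂ p₂x pw₁ px₁ h.xx₁ h.x₁w hqq'
  have r₁ := dist_le_one_or_of_four_cycle hconn halpha (a := m₁) (b := q₂) (c := p₂) (e := n₁)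
  have r₂ := dist_le_one_or_of_four_cycle hconn halpha (a := m₂) (b := q₁) (c := p₁) (e := n₂)
  have r₃ := dist_le_one_or_of_four_cycle hconn halpha (a := m₁) (b := q₁) (c := m₂) (e := q₂)
  have r₄ := dist_le_one_or_of_four_cycle hconn halpha (a := n₁) (b := p₁) (c := n₂) (e := p₂)
  have r₅ := dist_le_one_or_of_four_cycle hconn halpha (a := m₂) (b := q₁) (c := n₁) (e := p₂)
  have r₆ := dist_le_one_or_of_four_cycle hconn halpha (a := m₁) (b := q₂) (c := n₂) (e := p₁)
  have r₇ := dist_le_one_or_of_four_cycle hconn halpha (a := m₁) (b := m₂) (c := n₁) (e := n₂)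
  grind [SimpleGraph.dist_comm]

end HexagonalExcess

theorem MinimalExcess.false_of_sum_eq (hconn : G.Connected) (halpha : alphaMetric G 1)
    (h : G.MinimalExcess u v w x) (heq : G.dist u w + G.dist v x = G.dist u x + G.dist v w)
    (hu : G.dist u w + G.dist u x = G.dist w x + 1)
    (hv : G.dist v w + G.dist v x = G.dist w x + 1) : False := by
  have hs := h.sum_eq hconn halpha
  have t3 := hconn.dist_triangle (u := u) (v := w) (w := v)
  have t4 := hconn.dist_triangle (u := u) (v := x) (w := v)
  have c1 := G.dist_comm (u := w) (v := u)
  have c2 := G.dist_comm (u := w) (v := v)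
  have c3 := G.dist_comm (u := x) (v := u)
  have c4 := G.dist_comm (u := x) (v := v)
  have c5 := G.dist_comm (u := x) (v := w)
  have huv : G.dist u v = 4 := by omega
  have hwv : G.dist v w = G.dist u w := by omega
  have hxv : G.dist v x = G.dist u x := by omega
  clear hs
  have b4 := h.swap_pairs.swap_left.almost_between hconn halpha
  have b3 := h.swap_pairs.almost_between hconn halpha
  rcases b3 with b3 | ⟨b3, -, w₁, w₂, ww₁, ww₂, w₁₂, w₁u, w₁v, w₁x, w₂v, w₂u, w₂x⟩
  · have hw : G.dist u w = 2 := by clear b4; omega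
    rcases b4 with b4 | ⟨b4, -, x₁, x₂, xx₁, xx₂, x₁₂, x₁u, x₁v, x₁w, x₂v, x₂u, x₂w⟩
    · have := dist_le_two_of_mem_slice hconn halpha (u := u) (v := v) 2 w x
        (by omega) (by omega) (by omega) (by omega)
      omega
    · exact false_of_midpoint hconn halpha huv (x := w) (p := x₁)
        (by omega) (by omega) (by omega) (by omega) (by omega)
  · have hw : G.dist u w = 3 := by clear b4; omega
    rcases b4 with b4 | ⟨b4, -, x₁, x₂, xx₁, xx₂, x₁₂, x₁u, x₁v, x₁w, x₂v, x₂u, x₂w⟩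
    · exact false_of_midpoint hconn halpha huv (x := x) (p := w₁)
        (by omega) (by omega) (by omega) (by omega) (by omega)
    · have d1 := G.dist_comm (u := u) (v := w₁)
      have d2 := G.dist_comm (u := u) (v := w₂)
      have d3 := G.dist_comm (u := u) (v := x₁)
      have d4 := G.dist_comm (u := u) (v := x₂)
      have d5 := G.dist_comm (u := v) (v := w₁)
      have d6 := G.dist_comm (u := v) (v := w₂)
      have d7 := G.dist_comm (u := v) (v := x₁)
      have d8 := G.dist_comm (u := v) (v := x₂)
      have hex : G.HexagonalExcess u v w x w₁ w₂ x₁ x₂ := by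
        constructor <;> first | exact h | omega
      exact hex.false hconn halpha

theorem MinimalExcess.false (hconn : G.Connected) (halpha : alphaMetric G 1)
    (h : G.MinimalExcess u v w x) : False := by
  have hs := h.sum_eq hconn halpha
  have e1 := h.sum_le hconn halpha
  have e2 := h.swap_right.sum_le hconn halpha
  have b1 := h.almost_between hconn halpha
  have b2 := h.swap_left.almost_between hconn halpha
  have b3 := h.swap_pairs.almost_between hconn halpha
  have b4 := h.swap_pairs.swap_left.almost_between hconn halpha
  have t1 := hconn.dist_triangle (u := w) (v := u) (w := x)
  have t2 := hconn.dist_triangle (u := w) (v := v) (w := x)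
  have t3 := hconn.dist_triangle (u := u) (v := w) (w := v)
  have t4 := hconn.dist_triangle (u := u) (v := x) (w := v)
  have c0 := G.dist_comm (u := v) (v := u)
  have c1 := G.dist_comm (u := w) (v := u)
  have c2 := G.dist_comm (u := w) (v := v)
  have c3 := G.dist_comm (u := x) (v := u)
  have c4 := G.dist_comm (u := x) (v := v)
  have c5 := G.dist_comm (u := x) (v := w)
  replace b1 := b1.imp_right And.left
  replace b2 := b2.imp_right And.left
  replace b3 := b3.imp_right And.left
  replace b4 := b4.imp_right And.left
  have heq := e1.antisymm (by omega)
  rcases (by omega : (G.dist u w + G.dist u x = G.dist w x + 1 ∧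
    G.dist v w + G.dist v x = G.dist w x + 1) ∨ (G.dist w u + G.dist w v = G.dist u v + 1 ∧
    G.dist x u + G.dist x v = G.dist u v + 1)) with ⟨f1, f2⟩ | ⟨f1, f2⟩
  · exact h.false_of_sum_eq hconn halpha heq f1 f2
  · exact h.swap_pairs.false_of_sum_eq hconn halpha (by omega) f1 f2

theorem not_fourPointExcess (G : SimpleGraph V) (hconn : G.Connected)
    (halpha : alphaMetric G 1) (u v w x : V) : ¬ G.FourPointExcess u v w x := by
  induction hn : G.fourPointSum u v w x using Nat.strong_induction_on generalizing u v w x with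
  | _ n ih =>
    subst hn
    intro h
    exact MinimalExcess.false hconn halpha
      ⟨h, fun u' v' w' x' hlt => ih _ hlt u' v' w' x' rfl⟩

end AlphaOne

end SimpleGraph

/-- Every `α_1`-metric graph is `1`-hyperbolic. -/
theorem stmt12 {V : Type*} [Fintype V] (G : SimpleGraph V) (hconn : G.Connected)
    (halpha : alphaMetric G 1) :
    hyperbolic G 2 := by
  have key : ∀ u v w x, ¬ G.FourPointExcess u v w x := G.not_fourPointExcess hconn halpha
  intro u v w x
  have h1 := key u v w x
  have h2 := key u w v x
  have h3 := key u x v w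
  simp only [SimpleGraph.FourPointExcess, G.dist_comm (u := w) (v := v),
    G.dist_comm (u := x) (v := v), G.dist_comm (u := x) (v := w)] at h1 h2 h3
  omega
end

section
/- Let G be an α_1-metric graph, let u,v be vertices of G, let 0 ≤ k ≤ d(u,v), and let x, y ∈ S_k(u,v) be adjacent. Then x and y have a common neighbour in S_{k-1}(u,v) and a common neighbour in S_{k+1}(u,v). -/
namespace SimpleGraph

variable {V : Type*} {G : SimpleGraph V}

lemma Connected.exists_adj_dist_eq_s13 (hconn : G.Connected) {a b : V} {n : ℕ}
    (h : G.dist a b = n + 1) : ∃ c, G.Adj a c ∧ G.dist c b = n := by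
  obtain ⟨p, hp⟩ := hconn.exists_walk_length_eq_dist a b
  cases p with
  | nil => simp at h
  | @cons _ c _ hac q =>
    refine ⟨c, hac, ?_⟩
    have h₁ := dist_le q
    have h₂ := hconn.dist_triangle (u := a) (v := c) (w := b)
    rw [dist_eq_one_iff_adj.mpr hac] at h₂
    rw [Walk.length_cons] at hp
    omega

lemma Connected.exists_common_neighbor (hconn : G.Connected) {a b : V}
    (h : G.dist a b = 2) : ∃ c, G.Adj a c ∧ G.Adj c b := by
  obtain ⟨c, hac, hc⟩ := hconn.exists_adj_dist_eq_s13 h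
  exact ⟨c, hac, dist_eq_one_iff_adj.mp hc⟩

lemma Connected.dist_eq_two (hconn : G.Connected) {a b c : V} (hab : G.Adj a b)
    (hbc : G.Adj b c) (hne : a ≠ c) (hac : ¬ G.Adj a c) : G.dist a c = 2 := by
  have h₀ := hconn.pos_dist_of_ne hne
  have h₁ : G.dist a c ≠ 1 := fun h => hac (dist_eq_one_iff_adj.mp h)
  have h₂ := hconn.dist_triangle (u := a) (v := b) (w := c)
  rw [dist_eq_one_iff_adj.mpr hab, dist_eq_one_iff_adj.mpr hbc] at h₂
  omega

lemma Connected.dist_le_succ_of_adj (hconn : G.Connected) {a b : V} (c : V)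
    (hab : G.Adj a b) : G.dist c b ≤ G.dist c a + 1 := by
  have h := hconn.dist_triangle (u := c) (v := a) (w := b)
  rwa [dist_eq_one_iff_adj.mpr hab] at h

end SimpleGraph

namespace alphaMetric

variable {V : Type*} {G : SimpleGraph V}

open SimpleGraph

/-- Balls are convex along common neighbours. -/
lemma dist_le_of_common_neighbor (halpha : alphaMetric G 1) (hconn : G.Connected)
    {a b c w : V} {n : ℕ} (hbw : G.Adj b w) (hwc : G.Adj w c) (hbc : G.dist b c = 2)
    (hb : G.dist a b = n) (hc : G.dist a c = n) : G.dist a w ≤ n := by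
  by_contra hlt
  have h₁ := hconn.dist_le_succ_of_adj a hbw
  have h₂ := dist_eq_one_iff_adj.mpr hbw
  have h₃ := dist_eq_one_iff_adj.mpr hwc
  have := halpha a b w c (by omega) (by omega) hbw
  omega

/-- If the adjacent vertices `x, y` of a slice have no common neighbour in the previous slice,
then their neighbours `x', y'` in that slice are at distance two, and every common neighbour
of `x'` and `y'` lies in that slice too. -/
lemma dist_eq_two_of_no_common_neighbor (halpha : alphaMetric G 1) (hconn : G.Connected)
    {u v x y x' y' : V} {k l : ℕ} (hkl : G.dist u v = k + 1 + l) (hadj : G.Adj x y)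
    (hno : ∀ z, G.Adj x z → G.Adj y z → G.dist u z = k → G.dist v z = l + 1 → False)
    (hxx' : G.Adj x x') (hux' : G.dist u x' = k) (hvx' : G.dist v x' = l + 1)
    (hyy' : G.Adj y y') (huy' : G.dist u y' = k) (hvy' : G.dist v y' = l + 1)
    (hux : G.dist u x = k + 1) (huy : G.dist u y = k + 1) :
    G.dist x' y' = 2 ∧
      ∀ w, G.Adj x' w → G.Adj w y' → G.dist u w = k ∧ G.dist v w = l + 1 := by
  have hx'y : ¬ G.Adj x' y := fun h => hno x' hxx' h.symm hux' hvx'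
  have hxy' : ¬ G.Adj x y' := fun h => hno y' h hyy' huy' hvy'
  have d₁ : G.dist x' y = 2 :=
    hconn.dist_eq_two hxx'.symm hadj (by rintro rfl; omega) hx'y
  have d₂ : G.dist x y' = 2 :=
    hconn.dist_eq_two hadj hyy' (by rintro rfl; omega) hxy'
  have e₁ := dist_eq_one_iff_adj.mpr hxx'
  have e₁' := dist_eq_one_iff_adj.mpr hxx'.symm
  have e₂ := dist_eq_one_iff_adj.mpr hadj
  have e₃ := dist_eq_one_iff_adj.mpr hyy'
  have hlow := halpha x' x y y' (by omega) (by omega) hadj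
  have hup := hconn.dist_le_succ_of_adj x' hyy'
  have hne : G.dist x' y' ≠ 3 := by
    intro h
    have := halpha u x' x y' (by omega) (by omega) hxx'.symm
    omega
  have htwo : G.dist x' y' = 2 := by omega
  refine ⟨htwo, fun w h₁ h₂ => ?_⟩
  have hu := halpha.dist_le_of_common_neighbor hconn h₁ h₂ htwo hux' huy'
  have hv := halpha.dist_le_of_common_neighbor hconn h₁ h₂ htwo hvx' hvy'
  have ht := hconn.dist_triangle (u := u) (v := w) (w := v)
  rw [dist_comm (u := w)] at ht
  omega

/-- Adjacent vertices of a slice have a common neighbour in the previous slice. -/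
lemma exists_common_neighbor_closer (halpha : alphaMetric G 1) (hconn : G.Connected)
    {u v : V} (k l : ℕ) (hkl : G.dist u v = k + l) (x y : V)
    (hux : G.dist u x = k) (hvx : G.dist v x = l)
    (huy : G.dist u y = k) (hvy : G.dist v y = l) (hadj : G.Adj x y) :
    ∃ z, G.Adj x z ∧ G.Adj y z ∧ G.dist u z + 1 = k ∧ G.dist v z = l + 1 := by
  induction k generalizing l x y with
  | zero =>
    rw [hconn.dist_eq_zero_iff] at hux huy
    exact absurd (hux.symm.trans huy) hadj.ne
  | succ k ih =>
    by_contra hcon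
    have hno : ∀ z, G.Adj x z → G.Adj y z → G.dist u z = k → G.dist v z = l + 1 → False :=
      fun z h₁ h₂ h₃ h₄ => hcon ⟨z, h₁, h₂, by omega, h₄⟩
    have hlevel : ∀ {a b}, G.Adj a b → G.dist v a = l → G.dist u b = k →
        G.dist v b = l + 1 := by
      intro a b hab ha hb
      have h₁ := hconn.dist_le_succ_of_adj v hab
      have h₂ := hconn.dist_triangle (u := u) (v := b) (w := v)
      rw [dist_comm (u := b)] at h₂
      omega
    have hdown : ∀ {x' y' : V}, G.Adj x x' → G.dist u x' = k → G.Adj y y' →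
        G.dist u y' = k → G.dist x' y' = 2 ∧
          ∀ w, G.Adj x' w → G.Adj w y' → G.dist u w = k ∧ G.dist v w = l + 1 :=
      fun hx hx' hy hy' => halpha.dist_eq_two_of_no_common_neighbor hconn hkl hadj hno
        hx hx' (hlevel hx hvx hx') hy hy' (hlevel hy hvy hy') hux huy
    obtain ⟨x', hxx', hux'⟩ := hconn.exists_adj_dist_eq_s13 (dist_comm.trans hux)
    obtain ⟨y', hyy', huy'⟩ := hconn.exists_adj_dist_eq_s13 (dist_comm.trans huy)
    rw [dist_comm] at hux' huy'
    have hvx' := hlevel hxx' hvx hux'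
    have hvy' := hlevel hyy' hvy huy'
    obtain ⟨htwo, hmid⟩ := hdown hxx' hux' hyy' huy'
    obtain ⟨w, hx'w, hwy'⟩ := hconn.exists_common_neighbor htwo
    obtain ⟨huw, hvw⟩ := hmid w hx'w hwy'
    obtain ⟨p, hx'p, hwp, hup, -⟩ := ih (l + 1) (by omega) x' w hux' hvx' huw hvw hx'w
    obtain ⟨q, hwq, hy'q, huq, -⟩ := ih (l + 1) (by omega) w y' huw hvw huy' hvy' hwy'
    have hpy' : ¬ G.Adj p y' := fun h => by
      have := (hmid p hx'p h).1
      omega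
    have hpq_ne : p ≠ q := by
      rintro rfl
      exact hpy' hy'q.symm
    have hpq : G.Adj p q := by
      by_contra h
      have := halpha.dist_le_of_common_neighbor hconn (a := u) hwp.symm hwq
        (hconn.dist_eq_two hwp.symm hwq hpq_ne h) rfl (by omega)
      omega
    have hxp_two : G.dist x p = 2 := by
      refine hconn.dist_eq_two hxx' hx'p (by rintro rfl; omega) fun h => ?_
      have := hconn.dist_le_succ_of_adj u h.symm
      omega
    have hpy'_two : G.dist p y' = 2 :=
      hconn.dist_eq_two hwp.symm hwy' (by rintro rfl; omega) hpy'
    have hxy'_le : G.dist x y' ≤ 2 := by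
      have := hconn.dist_le_succ_of_adj x hyy'
      rwa [dist_eq_one_iff_adj.mpr hadj] at this
    have hxq_ne_two : G.dist x q ≠ 2 := by
      intro h
      obtain ⟨r, hxr, hrq⟩ := hconn.exists_common_neighbor h
      have h₁ := hconn.dist_le_succ_of_adj u hxr.symm
      have h₂ := hconn.dist_le_succ_of_adj u hrq.symm
      have := ((hdown hxr (by omega) hyy' huy').2 q hrq hy'q.symm).1
      omega
    have hxq_three : G.dist x q = 3 := by
      have h₁ := hconn.dist_le_succ_of_adj x hpq
      have h₂ := hconn.dist_triangle (u := u) (v := q) (w := x)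
      rw [dist_comm (u := q)] at h₂
      omega
    have h₁ := dist_eq_one_iff_adj.mpr hpq
    have h₂ := dist_eq_one_iff_adj.mpr hy'q.symm
    have := halpha x p q y' (by omega) (by omega) hpq
    omega

end alphaMetric

/-- In an `α_1`-metric graph, two adjacent vertices `x, y` of a slice `S_k(u,v)`
have a common neighbour in `S_{k-1}(u,v)` and a common neighbour in
`S_{k+1}(u,v)`. (Note that necessarily `1 ≤ k ≤ d(u,v) - 1` here, so `k - 1`,
computed by truncated subtraction, is the expected value.) -/
theorem stmt13 {V : Type*} [Fintype V] (G : SimpleGraph V) (hconn : G.Connected)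
    (halpha : alphaMetric G 1) (u v : V) (k : ℕ) (hk : k ≤ G.dist u v)
    (x y : V) (hx : inSlice G u v k x) (hy : inSlice G u v k y)
    (hadj : G.Adj x y) :
    (∃ z : V, G.Adj x z ∧ G.Adj y z ∧ inSlice G u v (k - 1) z) ∧
    (∃ z : V, G.Adj x z ∧ G.Adj y z ∧ inSlice G u v (k + 1) z) := by
  obtain ⟨hxs, hux⟩ := hx
  obtain ⟨hys, huy⟩ := hy
  rw [SimpleGraph.dist_comm (u := x)] at hxs
  rw [SimpleGraph.dist_comm (u := y)] at hys
  have hvu : G.dist v u = G.dist u v := SimpleGraph.dist_comm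
  constructor
  · obtain ⟨z, hxz, hyz, huz, hvz⟩ := halpha.exists_common_neighbor_closer hconn (u := u) (v := v)
      k (G.dist v x) (by omega) x y hux rfl huy (by omega) hadj
    rw [SimpleGraph.dist_comm] at hvz
    exact ⟨z, hxz, hyz, by omega, by omega⟩
  · obtain ⟨z, hxz, hyz, hvz, huz⟩ := halpha.exists_common_neighbor_closer hconn (u := v) (v := u)
      (G.dist v x) k (by omega) x y rfl hux (by omega) huy hadj
    rw [SimpleGraph.dist_comm] at hvz
    exact ⟨z, hxz, hyz, by omega, huz⟩
end

section
/- In every α_1-metric graph G, the eccentricity of any vertex furthest from an arbitrary vertex is at least diam(G) - 2; that is, for all vertices u and v of G with d(u,v) = e(u), one has e(v) ≥ diam(G) - 2. -/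
/-- The eccentricity `e(v) = max_u d(v,u)` of a vertex `v`. -/
noncomputable def ecc {V : Type*} [Fintype V] (G : SimpleGraph V) (v : V) : ℕ :=
  Finset.univ.sup (G.dist v)

/-- The diameter `diam(G) = max_{u,v} d(u,v)`. -/
noncomputable def diam {V : Type*} [Fintype V] (G : SimpleGraph V) : ℕ :=
  Finset.univ.sup (ecc G)

namespace SimpleGraph

variable {V : Type*} {G : SimpleGraph V}

theorem Connected.exists_dist_eq_one (hG : G.Connected) {u v : V} (h : G.dist u v ≠ 0) :
    ∃ w, G.dist u w = 1 ∧ G.dist w v + 1 = G.dist u v := by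
  obtain ⟨p, hp⟩ := hG.exists_walk_length_eq_dist u v
  cases p with
  | nil => simp at h
  | @cons _ w _ hadj q =>
    refine ⟨w, dist_eq_one_iff_adj.2 hadj, ?_⟩
    have h1 := dist_le q
    have h2 := hG.dist_triangle (u := u) (v := w) (w := v)
    rw [dist_eq_one_iff_adj.2 hadj] at h2
    simp only [Walk.length_cons] at hp
    omega

/-- The `α_1`-metric property, phrased with distances only. -/
theorem le_dist_of_alphaMetric_one (hα : alphaMetric G 1) (u v w x : V)
    (hvw : G.dist v w = 1) (hu : G.dist u w = G.dist u v + 1)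
    (hx : G.dist v x = G.dist w x + 1) :
    G.dist u v + G.dist v x ≤ G.dist u x + 1 :=
  hα u v w x (by omega) (by omega) (dist_eq_one_iff_adj.1 hvw)

/-- Balls of an `α_1`-metric graph are convex; this is the case of paths of length two. -/
theorem dist_le_one_of_alphaMetric_one (hG : G.Connected) (hα : alphaMetric G 1)
    (z a b c : V) (hab : G.dist a b = 1) (hbc : G.dist b c = 1)
    (ha : G.dist z b = G.dist z a + 1) (hc : G.dist z b = G.dist z c + 1) :
    G.dist a c ≤ 1 := by
  by_contra h
  have h1 := hG.dist_triangle (u := a) (v := b) (w := c)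
  have h2 := le_dist_of_alphaMetric_one hα z a b c hab ha (by omega)
  omega

/-- A quadruple violating the four-point condition of `1`-hyperbolicity, with `d(u,v) + d(x,y)`
as the largest sum. -/
def FourPointViolation (G : SimpleGraph V) (u v x y : V) : Prop :=
  G.dist u x + G.dist v y + 3 ≤ G.dist u v + G.dist x y ∧
    G.dist u y + G.dist v x + 3 ≤ G.dist u v + G.dist x y

/-- The sum of the six distances between four vertices. -/
noncomputable def distSum (G : SimpleGraph V) (u v x y : V) : ℕ :=
  G.dist u v + G.dist x y + G.dist u x + G.dist v y + G.dist u y + G.dist v x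

/-- A four-point violation whose sum of distances is smallest possible. -/
def MinimalViolation (G : SimpleGraph V) (u v x y : V) : Prop :=
  G.FourPointViolation u v x y ∧
    ∀ u' v' x' y', G.FourPointViolation u' v' x' y' → G.distSum u v x y ≤ G.distSum u' v' x' y'

namespace MinimalViolation

variable {u v x y : V}

theorem swap_right (h : G.MinimalViolation u v x y) : G.MinimalViolation u v y x := by
  have hxy := G.dist_comm (u := x) (v := y)
  obtain ⟨⟨h1, h2⟩, h3⟩ := h
  refine ⟨⟨by omega, by omega⟩, fun u' v' x' y' h' => ?_⟩
  have := h3 u' v' x' y' h'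
  unfold distSum at *
  omega

theorem swap_left (h : G.MinimalViolation u v x y) : G.MinimalViolation v u x y := by
  have huv := G.dist_comm (u := u) (v := v)
  obtain ⟨⟨h1, h2⟩, h3⟩ := h
  refine ⟨⟨by omega, by omega⟩, fun u' v' x' y' h' => ?_⟩
  have := h3 u' v' x' y' h'
  unfold distSum at *
  omega

theorem swap_pairs (h : G.MinimalViolation u v x y) : G.MinimalViolation x y u v := by
  have e1 := G.dist_comm (u := u) (v := x)
  have e2 := G.dist_comm (u := u) (v := y)
  have e3 := G.dist_comm (u := v) (v := x)
  have e4 := G.dist_comm (u := v) (v := y)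
  obtain ⟨⟨h1, h2⟩, h3⟩ := h
  refine ⟨⟨by omega, by omega⟩, fun u' v' x' y' h' => ?_⟩
  have := h3 u' v' x' y' h'
  unfold distSum at *
  omega

theorem dist_ne_zero (hG : G.Connected) (h : G.MinimalViolation u v x y) :
    G.dist u v ≠ 0 ∧ G.dist u x ≠ 0 := by
  have h1 := hG.dist_triangle (u := u) (v := x) (w := v)
  have h2 := hG.dist_triangle (u := x) (v := u) (w := y)
  have h3 := hG.dist_triangle (u := x) (v := v) (w := y)
  have h4 := G.dist_comm (u := u) (v := x)
  have h5 := G.dist_comm (u := v) (v := x)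
  have h6 := hG.dist_triangle (u := u) (v := v) (w := x)
  obtain ⟨⟨h7, h8⟩, -⟩ := h
  omega

/-- Moving `u` one step towards `v` does not increase the distance to `x`. -/
theorem dist_le_of_step (hG : G.Connected) (hα : alphaMetric G 1)
    (h : G.MinimalViolation u v x y) {q : V} (hq : G.dist u q = 1)
    (hv : G.dist q v + 1 = G.dist u v) : G.dist q x ≤ G.dist u x := by
  by_contra hlt
  have h1 := hG.dist_triangle (u := q) (v := u) (w := x)
  have h2 := hG.dist_triangle (u := x) (v := u) (w := y)
  have e1 := G.dist_comm (u := u) (v := x)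
  have e2 := G.dist_comm (u := q) (v := x)
  have e3 := G.dist_comm (u := v) (v := x)
  have e4 := G.dist_comm (u := u) (v := q)
  have h3 := le_dist_of_alphaMetric_one hα x u q v hq (by omega) (by omega)
  obtain ⟨⟨h4, h5⟩, -⟩ := h
  omega

theorem le_of_step (hG : G.Connected) (hα : alphaMetric G 1)
    (h : G.MinimalViolation u v x y) {q : V} (hq : G.dist u q = 1)
    (hv : G.dist q v + 1 = G.dist u v) :
    G.dist u v + G.dist x y ≤ G.dist q x + G.dist v y + 3 ∨
      G.dist u v + G.dist x y ≤ G.dist q y + G.dist v x + 3 := by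
  by_contra! hlt
  have h1 := h.dist_le_of_step hG hα hq hv
  have h2 := h.swap_right.dist_le_of_step hG hα hq hv
  have h3 := h.2 q v x y ⟨by omega, by omega⟩
  unfold distSum at h3
  omega

theorem le_add_three (hG : G.Connected) (hα : alphaMetric G 1)
    (h : G.MinimalViolation u v x y) :
    G.dist u v + G.dist x y ≤ G.dist u x + G.dist v y + 3 ∨
      G.dist u v + G.dist x y ≤ G.dist u y + G.dist v x + 3 := by
  obtain ⟨q, hq, hv⟩ := hG.exists_dist_eq_one (h.dist_ne_zero hG).1
  have h1 := h.dist_le_of_step hG hα hq hv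
  have h2 := h.swap_right.dist_le_of_step hG hα hq hv
  have h3 := h.le_of_step hG hα hq hv
  omega

/-- The two possibilities for a neighbour of `u` on a geodesic to `x`. -/
theorem step_cases (hG : G.Connected) (hα : alphaMetric G 1)
    (h : G.MinimalViolation u v x y) {q : V} (hq : G.dist u q = 1)
    (hx : G.dist q x + 1 = G.dist u x) :
    (G.dist q v + 1 = G.dist u v ∧ G.dist q y = G.dist u y ∧
        G.dist u y + G.dist v x + 3 = G.dist u v + G.dist x y) ∨
      (G.dist q v = G.dist u v ∧ G.dist q y = G.dist u y + 1 ∧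
        G.dist u x + G.dist u y ≤ G.dist x y + 1) := by
  have e1 := G.dist_comm (u := u) (v := x)
  have e2 := G.dist_comm (u := q) (v := x)
  have e3 := G.dist_comm (u := v) (v := x)
  have e4 := G.dist_comm (u := u) (v := q)
  have t1 := hG.dist_triangle (u := q) (v := u) (w := v)
  have t2 := hG.dist_triangle (u := u) (v := q) (w := v)
  have t3 := hG.dist_triangle (u := q) (v := u) (w := y)
  have t4 := hG.dist_triangle (u := x) (v := u) (w := y)
  have hb := h.1
  unfold FourPointViolation at hb
  have hle : G.dist q v ≤ G.dist u v := by
    by_contra hlt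
    have h3 := le_dist_of_alphaMetric_one hα x q u v (by omega) (by omega) (by omega)
    omega
  rcases (show G.dist q v + 1 = G.dist u v ∨ G.dist q v = G.dist u v by omega) with hv | hv
  · left
    have h1 := h.swap_right.dist_le_of_step hG hα hq hv
    have h2 := h.le_of_step hG hα hq hv
    omega
  · right
    have hy : G.dist q y = G.dist u y + 1 := by
      by_contra hne
      have h3 := h.2 q v x y ⟨by omega, by omega⟩
      unfold distSum at h3
      omega
    have h3 := le_dist_of_alphaMetric_one hα x q u y (by omega) (by omega) (by omega)
    omega

theorem corner_cases (hG : G.Connected) (hα : alphaMetric G 1)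
    (h : G.MinimalViolation u v x y) :
    (G.dist u y + G.dist v x + 3 = G.dist u v + G.dist x y ∧
        G.dist x y + 1 ≤ G.dist u x + G.dist u y) ∨
      (G.dist u x + G.dist u y ≤ G.dist x y + 1 ∧
        G.dist u v + 1 ≤ G.dist u x + G.dist v x) := by
  obtain ⟨q, hq, hx⟩ := hG.exists_dist_eq_one (h.dist_ne_zero hG).2
  have e2 := G.dist_comm (u := q) (v := x)
  have e3 := G.dist_comm (u := v) (v := x)
  have t1 := hG.dist_triangle (u := q) (v := x) (w := v)
  have t2 := hG.dist_triangle (u := x) (v := q) (w := y)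
  have := h.step_cases hG hα hq hx
  omega

theorem add_le_add_two (hG : G.Connected) (hα : alphaMetric G 1)
    (h : G.MinimalViolation u v x y) :
    G.dist u x + G.dist u y ≤ G.dist x y + 2 := by
  obtain ⟨q, hq, hx⟩ := hG.exists_dist_eq_one (h.dist_ne_zero hG).2
  obtain ⟨r, hr, hy⟩ := hG.exists_dist_eq_one (h.swap_right.dist_ne_zero hG).2
  have e0 := G.dist_comm (u := x) (v := y)
  have e1 := G.dist_comm (u := u) (v := q)
  have e2 := G.dist_comm (u := u) (v := v)
  have e3 := G.dist_comm (u := q) (v := v)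
  have e4 := G.dist_comm (u := r) (v := v)
  have e5 := G.dist_comm (u := q) (v := x)
  have e6 := G.dist_comm (u := r) (v := x)
  rcases h.step_cases hG hα hq hx with ⟨a1, a2, -⟩ | hB
  · rcases h.swap_right.step_cases hG hα hr hy with ⟨b1, b2, -⟩ | hB
    · have h1 := dist_le_one_of_alphaMetric_one hG hα v q u r (by omega) hr (by omega) (by omega)
      have t1 := hG.dist_triangle (u := x) (v := q) (w := r)
      have h2 := le_dist_of_alphaMetric_one hα x q r y (by omega) (by omega) (by omega)
      omega
    · omega
  · omega

/-- The integer points of the linear system satisfied by the distances of a minimal violation. -/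
theorem dist_system {n m a b c d : ℕ}
    (h0 : n + m ≤ a + b + 3 ∨ n + m ≤ c + d + 3)
    (hb : a + b + 3 ≤ n + m) (hb' : c + d + 3 ≤ n + m)
    (u1 : (c + d + 3 = n + m ∧ m + 1 ≤ a + c) ∨ (a + c ≤ m + 1 ∧ n + 1 ≤ a + d))
    (u2 : (a + b + 3 = n + m ∧ m + 1 ≤ a + c) ∨ (a + c ≤ m + 1 ∧ n + 1 ≤ b + c))
    (v1 : (a + b + 3 = n + m ∧ m + 1 ≤ b + d) ∨ (b + d ≤ m + 1 ∧ n + 1 ≤ a + d))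
    (v2 : (c + d + 3 = n + m ∧ m + 1 ≤ b + d) ∨ (b + d ≤ m + 1 ∧ n + 1 ≤ b + c))
    (x1 : (c + d + 3 = n + m ∧ n + 1 ≤ a + d) ∨ (a + d ≤ n + 1 ∧ m + 1 ≤ a + c))
    (y1 : (c + d + 3 = n + m ∧ n + 1 ≤ b + c) ∨ (b + c ≤ n + 1 ∧ m + 1 ≤ b + d))
    (x2 : (a + b + 3 = n + m ∧ n + 1 ≤ a + d) ∨ (a + d ≤ n + 1 ∧ m + 1 ≤ b + d))
    (y2 : (a + b + 3 = n + m ∧ n + 1 ≤ b + c) ∨ (b + c ≤ n + 1 ∧ m + 1 ≤ a + c))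
    (u3 : a + c ≤ m + 2) (v3 : b + d ≤ m + 2) (x3 : a + d ≤ n + 2) (y3 : b + c ≤ n + 2)
    (tu : m ≤ a + c) (tv : m ≤ b + d) (tx : n ≤ a + d) (ty : n ≤ b + c) :
    (m = 4 ∧ ((n = 3 ∧ a = 2 ∧ b = 2 ∧ c = 2 ∧ d = 2) ∨ (n = 4 ∧ a = 2 ∧ b = 3 ∧ c = 2 ∧ d = 3) ∨
      (n = 4 ∧ a = 3 ∧ b = 2 ∧ c = 3 ∧ d = 2) ∨ (n = 5 ∧ a = 3 ∧ b = 3 ∧ c = 3 ∧ d = 3))) ∨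
    (n = 4 ∧ ((m = 3 ∧ a = 2 ∧ b = 2 ∧ c = 2 ∧ d = 2) ∨ (m = 4 ∧ a = 2 ∧ b = 3 ∧ c = 3 ∧ d = 2) ∨
      (m = 4 ∧ a = 3 ∧ b = 2 ∧ c = 2 ∧ d = 3) ∨ (m = 5 ∧ a = 3 ∧ b = 3 ∧ c = 3 ∧ d = 3))) := by
  have h1 : c + d + 3 = n + m := by
    by_contra hne
    have hu := u1.resolve_left fun h => hne h.1
    have hv := v2.resolve_left fun h => hne h.1
    have hx := x1.resolve_left fun h => hne h.1
    have hy := y1.resolve_left fun h => hne h.1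
    clear u1 u2 v1 v2 x1 x2 y1 y2
    omega
  have h2 : a + b + 3 = n + m := by
    by_contra hne
    have hu := u2.resolve_left fun h => hne h.1
    have hv := v1.resolve_left fun h => hne h.1
    have hx := x2.resolve_left fun h => hne h.1
    have hy := y2.resolve_left fun h => hne h.1
    clear u1 u2 v1 v2 x1 x2 y1 y2
    omega
  have hac : m + 1 ≤ a + c ∨ n + 1 ≤ a + d := u1.imp And.right And.right
  have had : m + 1 ≤ a + c ∨ n + 1 ≤ b + c := u2.imp And.right And.right
  have hbc : m + 1 ≤ b + d ∨ n + 1 ≤ a + d := v1.imp And.right And.right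
  have hbd : m + 1 ≤ b + d ∨ n + 1 ≤ b + c := v2.imp And.right And.right
  clear h0 hb hb' u1 u2 v1 v2 x1 x2 y1 y2
  have key : (m + 1 ≤ a + c ∧ m + 1 ≤ b + d) ∨ (n + 1 ≤ a + d ∧ n + 1 ≤ b + c) := by tauto
  clear hac had hbc hbd
  have ha : 2 ≤ a ∧ a ≤ 3 := by omega
  have hb : 2 ≤ b ∧ b ≤ 3 := by omega
  have hc : 2 ≤ c ∧ c ≤ 3 := by omega
  have hd : 2 ≤ d ∧ d ≤ 3 := by omega
  obtain ⟨ha2, ha3⟩ := ha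
  obtain ⟨hb2, hb3⟩ := hb
  obtain ⟨hc2, hc3⟩ := hc
  obtain ⟨hd2, hd3⟩ := hd
  obtain rfl : n = a + b + 3 - m := by omega
  interval_cases a <;> interval_cases b <;> interval_cases c <;> interval_cases d <;>
    omega

/-- Up to symmetry, a minimal violation has one of three distance patterns. -/
theorem dist_cases (hG : G.Connected) (hα : alphaMetric G 1)
    (h : G.MinimalViolation u v x y) :
    ∃ u v x y, G.MinimalViolation u v x y ∧ G.dist x y = 4 ∧
      ((G.dist u v = 3 ∧ G.dist u x = 2 ∧ G.dist u y = 2 ∧ G.dist v x = 2 ∧ G.dist v y = 2) ∨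
       (G.dist u v = 4 ∧ G.dist u x = 2 ∧ G.dist u y = 2 ∧ G.dist v x = 3 ∧ G.dist v y = 3) ∨
       (G.dist u v = 5 ∧ G.dist u x = 3 ∧ G.dist u y = 3 ∧ G.dist v x = 3 ∧ G.dist v y = 3)) := by
  have e1 := G.dist_comm (u := u) (v := x)
  have e2 := G.dist_comm (u := u) (v := y)
  have e3 := G.dist_comm (u := v) (v := x)
  have e4 := G.dist_comm (u := v) (v := y)
  have e5 := G.dist_comm (u := u) (v := v)
  have e6 := G.dist_comm (u := x) (v := y)
  have u1 := h.corner_cases hG hα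
  have u2 := h.swap_right.corner_cases hG hα
  have v1 := h.swap_left.corner_cases hG hα
  have v2 := h.swap_left.swap_right.corner_cases hG hα
  have x1 := h.swap_pairs.corner_cases hG hα
  have x2 := h.swap_pairs.swap_right.corner_cases hG hα
  have y1 := h.swap_pairs.swap_left.swap_right.corner_cases hG hα
  have y2 := h.swap_pairs.swap_left.corner_cases hG hα
  have u3 := h.add_le_add_two hG hα
  have v3 := h.swap_left.add_le_add_two hG hα
  have x3 := h.swap_pairs.add_le_add_two hG hα
  have y3 := h.swap_pairs.swap_left.add_le_add_two hG hα
  have tu := hG.dist_triangle (u := x) (v := u) (w := y)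
  have tv := hG.dist_triangle (u := x) (v := v) (w := y)
  have tx := hG.dist_triangle (u := u) (v := x) (w := v)
  have ty := hG.dist_triangle (u := u) (v := y) (w := v)
  have key := dist_system (h.le_add_three hG hα) h.1.1 h.1.2 (by omega) (by omega) (by omega)
    (by omega) (by omega) (by omega) (by omega) (by omega) u3 (by omega)
    (by omega) (by omega) (by omega) (by omega) (by omega) (by omega)
  rcases key with ⟨hm, k | k | k | k⟩ | ⟨hn, k | k | k | k⟩
  · exact ⟨u, v, x, y, h, by omega⟩
  · exact ⟨u, v, x, y, h, by omega⟩
  · exact ⟨v, u, x, y, h.swap_left, by omega⟩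
  · exact ⟨u, v, x, y, h, by omega⟩
  · exact ⟨x, y, u, v, h.swap_pairs, by omega⟩
  · exact ⟨x, y, u, v, h.swap_pairs, by omega⟩
  · exact ⟨y, x, u, v, h.swap_pairs.swap_left, by omega⟩
  · exact ⟨x, y, u, v, h.swap_pairs, by omega⟩

theorem false_of_dist_eq_three (hG : G.Connected) (hα : alphaMetric G 1)
    (h : G.MinimalViolation u v x y) (hxy : G.dist x y = 4) (huv : G.dist u v = 3)
    (hux : G.dist u x = 2) (huy : G.dist u y = 2) (hvx : G.dist v x = 2) (hvy : G.dist v y = 2) :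
    False := by
  obtain ⟨q, hq, hqx⟩ := hG.exists_dist_eq_one (u := u) (v := x) (by omega)
  obtain ⟨r, hr, hrx⟩ := hG.exists_dist_eq_one (u := v) (v := x) (by omega)
  have e1 := G.dist_comm (u := u) (v := y)
  have e2 := G.dist_comm (u := q) (v := y)
  have e3 := G.dist_comm (u := r) (v := y)
  have e4 := G.dist_comm (u := r) (v := u)
  have e5 := G.dist_comm (u := v) (v := u)
  have e6 := G.dist_comm (u := r) (v := x)
  have t1 := hG.dist_triangle (u := q) (v := x) (w := r)
  have t2 := hG.dist_triangle (u := u) (v := q) (w := r)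
  have t3 := hG.dist_triangle (u := x) (v := q) (w := y)
  have t4 := hG.dist_triangle (u := x) (v := r) (w := y)
  have e7 := G.dist_comm (u := q) (v := x)
  have h1 := h.step_cases hG hα hq hqx
  have h2 := h.swap_left.step_cases hG hα hr hrx
  have h3 := le_dist_of_alphaMetric_one hα y u q r hq (by omega) (by omega)
  omega

theorem false_of_dist_eq_four (hG : G.Connected) (hα : alphaMetric G 1)
    (h : G.MinimalViolation u v x y) (hxy : G.dist x y = 4) (huv : G.dist u v = 4)
    (hux : G.dist u x = 2) (huy : G.dist u y = 2) (hvx : G.dist v x = 3) (hvy : G.dist v y = 3) :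
    False := by
  obtain ⟨q, hq, hqx⟩ := hG.exists_dist_eq_one (u := u) (v := x) (by omega)
  have e1 := G.dist_comm (u := x) (v := y)
  have e2 := G.dist_comm (u := q) (v := y)
  have e3 := G.dist_comm (u := v) (v := y)
  have e4 := G.dist_comm (u := v) (v := x)
  have e5 := G.dist_comm (u := q) (v := x)
  have t3 := hG.dist_triangle (u := x) (v := q) (w := y)
  have h1 := h.step_cases hG hα hq hqx
  have h3 := le_dist_of_alphaMetric_one hα y q x v (by omega) (by omega) (by omega)
  omega

/-- In the third pattern, vertices `r`, `r'`, `s` near `u`, with `r, s` on a `(u,x)`-geodesic and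
`r'` on a `(u,y)`-geodesic. -/
theorem exists_of_dist_eq_five (hG : G.Connected) (hα : alphaMetric G 1)
    (h : G.MinimalViolation u v x y) (hxy : G.dist x y = 4) (huv : G.dist u v = 5)
    (hux : G.dist u x = 3) (huy : G.dist u y = 3) (hvx : G.dist v x = 3) (hvy : G.dist v y = 3) :
    ∃ r r' s, G.dist u r = 1 ∧ G.dist u r' = 1 ∧ G.dist r r' = 1 ∧ G.dist r s = 1 ∧
      G.dist s x = 1 ∧ G.dist r y = 3 ∧ G.dist r' y = 2 ∧ G.dist r' v = 4 ∧ G.dist r' x = 3 ∧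
      G.dist s u = 2 ∧ G.dist s v = 3 ∧ G.dist s y = 3 := by
  obtain ⟨r, hr, hrx⟩ := hG.exists_dist_eq_one (u := u) (v := x) (by omega)
  obtain ⟨r', hr', hry⟩ := hG.exists_dist_eq_one (u := u) (v := y) (by omega)
  obtain ⟨s, hrs, hsx⟩ := hG.exists_dist_eq_one (u := r) (v := x) (by omega)
  obtain ⟨y', hry', hyy⟩ := hG.exists_dist_eq_one (u := r') (v := y) (by omega)
  have h1 := h.step_cases hG hα hr hrx
  have h2 := h.swap_right.step_cases hG hα hr' hry
  have e1 := G.dist_comm (u := u) (v := r)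
  have e2 := G.dist_comm (u := r) (v := v)
  have e3 := G.dist_comm (u := r') (v := v)
  have e4 := G.dist_comm (u := u) (v := v)
  have e5 := G.dist_comm (u := s) (v := x)
  have e6 := G.dist_comm (u := y') (v := y)
  have e7 := G.dist_comm (u := x) (v := y)
  have e8 := G.dist_comm (u := s) (v := u)
  have e9 := G.dist_comm (u := y') (v := u)
  have e10 := G.dist_comm (u := x) (v := u)
  have e11 := G.dist_comm (u := y) (v := u)
  have e12 := G.dist_comm (u := x) (v := v)
  have e13 := G.dist_comm (u := y) (v := v)
  have e14 := G.dist_comm (u := y') (v := v)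
  have e15 := G.dist_comm (u := s) (v := v)
  have e16 := G.dist_comm (u := s) (v := y)
  have e17 := G.dist_comm (u := r') (v := y')
  have e18 := G.dist_comm (u := r') (v := r)
  have t1 := hG.dist_triangle (u := u) (v := r) (w := s)
  have t2 := hG.dist_triangle (u := u) (v := s) (w := x)
  have t3 := hG.dist_triangle (u := u) (v := r') (w := y')
  have t4 := hG.dist_triangle (u := u) (v := y') (w := y)
  have t5 := hG.dist_triangle (u := r) (v := r') (w := x)
  have t6 := hG.dist_triangle (u := r') (v := r) (w := s)
  have t7 := hG.dist_triangle (u := y') (v := r') (w := s)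
  have t8 := hG.dist_triangle (u := y) (v := y') (w := s)
  have t9 := hG.dist_triangle (u := r') (v := s) (w := x)
  have hrr := dist_le_one_of_alphaMetric_one hG hα v r u r' (by omega) hr' (by omega) (by omega)
  have h3 := h.swap_pairs.step_cases hG hα (q := s) (by omega) (by omega)
  have h4 := h.swap_pairs.swap_left.step_cases hG hα (q := y') (by omega) (by omega)
  have hrr' : G.dist r r' = 1 := by
    have t10 := hG.dist_triangle (u := r') (v := r) (w := x)
    omega
  refine ⟨r, r', s, hr, hr', hrr', hrs, ?_⟩
  suffices G.dist s v ≠ 4 by omega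
  intro hsv
  rcases (show G.dist y' v = 3 ∨ G.dist y' v = 4 by omega) with hy | hy
  · have h5 := le_dist_of_alphaMetric_one hα v y' r' s (by omega) (by omega) (by omega)
    omega
  · have h5 := le_dist_of_alphaMetric_one hα v y y' s (by omega) (by omega) (by omega)
    omega

theorem false_of_dist_eq_five (hG : G.Connected) (hα : alphaMetric G 1)
    (h : G.MinimalViolation u v x y) (hxy : G.dist x y = 4) (huv : G.dist u v = 5)
    (hux : G.dist u x = 3) (huy : G.dist u y = 3) (hvx : G.dist v x = 3) (hvy : G.dist v y = 3) :
    False := by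
  obtain ⟨r, r', s, hur, hur', hrr', hrs, hsx, hry, hr'y, hr'v, hr'x, hsu, hsv, hsy⟩ :=
    h.exists_of_dist_eq_five hG hα hxy huv hux huy hvx hvy
  obtain ⟨q, q', t, hvq, hvq', hqq', hqt, htx, hqy, hq'y, hq'u, hq'x, htv, htu, hty⟩ :=
    h.swap_left.exists_of_dist_eq_five hG hα hxy (by rw [dist_comm, huv]) hvx hvy hux huy
  have c := fun a b => G.dist_comm (u := a) (v := b)
  have tri := fun a b c => hG.dist_triangle (u := a) (v := b) (w := c)
  have hst : G.dist s t = 1 := by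
    have h1 := dist_le_one_of_alphaMetric_one hG hα y s x t hsx (by rw [c, htx])
      (by rw [c y x, c y s]; omega) (by rw [c y x, c y t]; omega)
    have h2 := tri t s u
    have h3 := c t s
    omega
  have hr't : G.dist r' t = 2 := by
    have h1 := tri r' r t
    have h2 := tri r s t
    have h3 := tri u r t
    have h4 := tri u r' t
    have h5 := c u t
    have h6 := c r' r
    by_contra hne
    have h7 := le_dist_of_alphaMetric_one hα y r' r t (by omega) (by rw [c y r, c y r']; omega)
      (by omega)
    rw [c y r', c y t] at h7
    omega
  have hq's : G.dist q' s = 2 := by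
    have h1 := tri q' q s
    have h2 := tri q t s
    have h3 := tri v q s
    have h4 := tri v q' s
    have h5 := c v s
    have h6 := c q' q
    have h8 := c t s
    by_contra hne
    have h7 := le_dist_of_alphaMetric_one hα y q' q s (by omega) (by rw [c y q, c y q']; omega)
      (by omega)
    rw [c y q', c y s] at h7
    omega
  obtain ⟨g, hr'g, hgt⟩ := hG.exists_dist_eq_one (u := r') (v := t) (by omega)
  obtain ⟨k, hq'k, hks⟩ := hG.exists_dist_eq_one (u := q') (v := s) (by omega)
  have hug : G.dist u g = 2 := by
    have h1 := tri u r' g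
    have h2 := tri u g t
    have h3 := c u t
    omega
  have hvg : G.dist v g = 3 := by
    have h1 := tri v t g
    have h2 := tri v g r'
    have h3 := c v t
    have h4 := c t g
    have h5 := c g r'
    have h6 := c v r'
    omega
  have hvk : G.dist v k = 2 := by
    have h1 := tri v q' k
    have h2 := tri v k s
    have h3 := c v s
    omega
  have huk : G.dist u k = 3 := by
    have h1 := tri u s k
    have h2 := tri u k q'
    have h3 := c u s
    have h4 := c s k
    have h5 := c k q'
    have h6 := c u q'
    omega
  have hyg := tri g t x
  have hyg' := tri x g y
  have hyg'' := tri g r' y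
  have hyk' := tri y q' k
  have hyk'' := tri s k y
  have hsg : G.dist s g ≤ 1 :=
    dist_le_one_of_alphaMetric_one hG hα u s t g hst (by rw [c]; omega)
      (by rw [c u t, c u s]; omega) (by rw [c u t]; omega)
  have e1 := c g r'
  have e2 := c g x
  have e3 := c g t
  have e4 := c g y
  have e5 := c k y
  have e6 := c k s
  have e7 := c q' y
  have e8 := c r' y
  have e9 := c t y
  have e10 := c s y
  have e11 := c t v
  have e12 := c s u
  have t1 := tri k s g
  have t2 := tri q' k g
  have t3 := tri v q' g
  have hyg2 : G.dist g y ≠ 2 := fun hg => by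
    have h1 := le_dist_of_alphaMetric_one hα v t g y (by omega) (by omega) (by omega)
    omega
  have hyk2 : G.dist k y ≠ 2 := fun hk => by
    have h1 := le_dist_of_alphaMetric_one hα u s k y (by omega) (by omega) (by omega)
    omega
  rcases (show G.dist q' g = 2 ∨ G.dist q' g = 3 by omega) with hq'g | hq'g
  · have e13 := c g q'
    have e14 := c u q'
    have t4 := tri u r' q'
    have t5 := tri r' g q'
    have h1 := le_dist_of_alphaMetric_one hα y r' g q' hr'g (by omega) (by omega)
    omega
  · have h1 := le_dist_of_alphaMetric_one hα y q' k g hq'k (by omega) (by omega)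
    omega

end MinimalViolation

/-- `α_1`-metric graphs are `1`-hyperbolic. -/
theorem not_fourPointViolation_of_alphaMetric_one (hG : G.Connected) (hα : alphaMetric G 1)
    (u v x y : V) : ¬ G.FourPointViolation u v x y := by
  intro h
  let P : Set (V × V × V × V) := {p | G.FourPointViolation p.1 p.2.1 p.2.2.1 p.2.2.2}
  let f : V × V × V × V → ℕ := fun p => G.distSum p.1 p.2.1 p.2.2.1 p.2.2.2
  obtain ⟨p, hp, hmin⟩ := (measure f).wf.has_min P ⟨(u, v, x, y), h⟩
  have hp' : G.MinimalViolation p.1 p.2.1 p.2.2.1 p.2.2.2 :=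
    ⟨hp, fun u' v' x' y' h' => not_lt.1 (hmin (u', v', x', y') h')⟩
  obtain ⟨u, v, x, y, hm, hxy, ⟨h1, h2, h3, h4, h5⟩ | ⟨h1, h2, h3, h4, h5⟩ |
    ⟨h1, h2, h3, h4, h5⟩⟩ := hp'.dist_cases hG hα
  · exact hm.false_of_dist_eq_three hG hα hxy h1 h2 h3 h4 h5
  · exact hm.false_of_dist_eq_four hG hα hxy h1 h2 h3 h4 h5
  · exact hm.false_of_dist_eq_five hG hα hxy h1 h2 h3 h4 h5

end SimpleGraph

/-- In every `α_1`-metric graph, the eccentricity of any vertex `v` furthest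
from an arbitrary vertex `u` (i.e. with `d(u,v) = e(u)`) is at least
`diam(G) - 2`, i.e. `diam(G) ≤ e(v) + 2`. -/
theorem stmt14 {V : Type*} [Fintype V] (G : SimpleGraph V) (hconn : G.Connected)
    (halpha : alphaMetric G 1) (u v : V) (hfar : G.dist u v = ecc G u) :
    diam G ≤ ecc G v + 2 := by
  refine Finset.sup_le fun x _ => Finset.sup_le fun y _ => ?_
  have hux : G.dist u x ≤ ecc G u := Finset.le_sup (f := G.dist u) (Finset.mem_univ x)
  have huy : G.dist u y ≤ ecc G u := Finset.le_sup (f := G.dist u) (Finset.mem_univ y)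
  have hvx : G.dist v x ≤ ecc G v := Finset.le_sup (f := G.dist v) (Finset.mem_univ x)
  have hvy : G.dist v y ≤ ecc G v := Finset.le_sup (f := G.dist v) (Finset.mem_univ y)
  have h := SimpleGraph.not_fourPointViolation_of_alphaMetric_one hconn halpha u v x y
  unfold SimpleGraph.FourPointViolation at h
  omega
end
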